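/- Let G be a strongly 3-cut-connected graph in which every connected component contains at most three cut vertices. If G is accessible, then J_G is strongly unmixed. -/

import Mathlib

open SimpleGraph

universe u u'

/-- The number of connected components of the induced subgraph of `G` on the vertex set `A`. -/
noncomputable def cComp {V : Type u} (G : SimpleGraph V) (A : Set V) : ℕ :=
  Nat.card (G.induce A).ConnectedComponent

/-- `x` is a cut vertex of the induced subgraph of `G` on `A`: removing `x`
increases the number of connected components. -/
def CutVertexOn {V : Type u} (G : SimpleGraph V) (A : Set V) (x : V) : Prop :=
  x ∈ A ∧ cComp G A < cComp G (A \ {x})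

/-- `T` is a cutset of the induced subgraph of `G` on `A`: every `t ∈ T` is a
cut vertex of `G[A] ∖ (T ∖ {t})`. -/
def CutsetOn {V : Type u} [DecidableEq V] (G : SimpleGraph V) (A : Set V) (T : Finset V) :
    Prop :=
  ↑T ⊆ A ∧ ∀ t ∈ T, CutVertexOn G (A \ ↑(T.erase t)) t

/-- The binomial edge ideal of the induced subgraph of `G` on `A` is unmixed
(combinatorial characterization): `c(T) = |T| + c(∅)` for every cutset `T`. -/
def UnmixedOn {V : Type u} [DecidableEq V] (G : SimpleGraph V) (A : Set V) : Prop :=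
  ∀ T : Finset V, CutsetOn G A T → cComp G (A \ ↑T) = T.card + cComp G A

/-- The induced subgraph of `G` on `A` is accessible. -/
def AccessibleOn {V : Type u} [DecidableEq V] (G : SimpleGraph V) (A : Set V) : Prop :=
  UnmixedOn G A ∧
    ∀ T : Finset V, CutsetOn G A T → T.Nonempty → ∃ t ∈ T, CutsetOn G A (T.erase t)

/-- The graph `(G[A])_x`: add all edges between neighbours of `x` lying in `A`. -/
def cliqueAtOn {V : Type u} (G : SimpleGraph V) (A : Set V) (x : V) : SimpleGraph V :=
  G ⊔ SimpleGraph.fromRel (fun a b => a ∈ A ∧ b ∈ A ∧ G.Adj x a ∧ G.Adj x b)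

/-- The binomial edge ideal of the induced subgraph of `G` on `A` is strongly unmixed. -/
inductive StronglyUnmixedOn {V : Type u} [DecidableEq V] : SimpleGraph V → Set V → Prop
  | complete (G : SimpleGraph V) (A : Set V)
      (h : ∀ a b : A, (G.induce A).Reachable a b → a ≠ b → (G.induce A).Adj a b) :
      StronglyUnmixedOn G A
  | cut (G : SimpleGraph V) (A : Set V) (hU : UnmixedOn G A) (x : V)
      (hx : CutVertexOn G A x)
      (h1 : StronglyUnmixedOn G (A \ {x}))
      (h2 : StronglyUnmixedOn (cliqueAtOn G A x) A)
      (h3 : StronglyUnmixedOn (cliqueAtOn G A x) (A \ {x})) :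
      StronglyUnmixedOn G A

/-- `x` is a free vertex of `G`: the induced subgraph on `N(x) ∪ {x}` is complete. -/
def FreeVertex {V : Type u} (G : SimpleGraph V) (x : V) : Prop :=
  ∀ a b : V, G.Adj x a → G.Adj x b → a ≠ b → G.Adj a b

/-- Attach a whisker (pendant vertex) at each vertex of `Wv`.  `Sum.inl a` is the
original vertex `a` and `Sum.inr x` is the whisker vertex `f_x` attached at `x ∈ Wv`. -/
def whiskered {V : Type u} (G : SimpleGraph V) (Wv : Set V) : SimpleGraph (V ⊕ V) :=
  SimpleGraph.fromRel (fun a b =>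
    (∃ x y, G.Adj x y ∧ a = Sum.inl x ∧ b = Sum.inl y) ∨
    (∃ x ∈ Wv, a = Sum.inl x ∧ b = Sum.inr x))

/-- `B` is (the vertex set of) a block of `G`: a maximal connected induced
subgraph having no cut vertex. -/
def IsBlock {V : Type u} (G : SimpleGraph V) (B : Set V) : Prop :=
  (G.induce B).Connected ∧ (∀ x, ¬ CutVertexOn G B x) ∧
    ∀ B' : Set V, B ⊆ B' → (G.induce B').Connected → (∀ x, ¬ CutVertexOn G B' x) → B' = B

/-- Glue two graphs `G` and `H`, identifying the vertex `x` of `G` with the vertex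
`y` of `H` (the identified vertex is `Sum.inl x`). -/
def glueAt {V : Type u} {W : Type u'} (G : SimpleGraph V) (H : SimpleGraph W) (x : V) (y : W) :
    SimpleGraph (V ⊕ W) :=
  SimpleGraph.fromRel (fun a b =>
    (∃ p q, G.Adj p q ∧ a = Sum.inl p ∧ b = Sum.inl q) ∨
    (∃ p q, H.Adj p q ∧ p ≠ y ∧ q ≠ y ∧ a = Sum.inr p ∧ b = Sum.inr q) ∨
    (∃ q, H.Adj y q ∧ a = Sum.inl x ∧ b = Sum.inr q))

/-- The star product `K_m ⋆_r K_n`: two complete graphs, on `{x₁,…,x_m}` (the `inl`s)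
and `{y₁,…,y_n}` (the `inr`s), together with the matching edges `{x_i, y_i}` for `1 ≤ i ≤ r`
(indices `0,…,r-1` here). -/
def starProd (m n r : ℕ) : SimpleGraph (Fin m ⊕ Fin n) :=
  SimpleGraph.fromRel (fun a b =>
    (∃ x y : Fin m, a = Sum.inl x ∧ b = Sum.inl y) ∨
    (∃ x y : Fin n, a = Sum.inr x ∧ b = Sum.inr y) ∨
    (∃ (x : Fin m) (y : Fin n), (x : ℕ) = (y : ℕ) ∧ (x : ℕ) < r ∧
      a = Sum.inl x ∧ b = Sum.inr y))

/-- The vertices `x_i, y_i` for `2 ≤ i ≤ r` (indices `1,…,r-1` here), at which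
whiskers are attached to form `overline(K_m ⋆_r K_n)`. -/
def starWhisk (m n r : ℕ) : Set (Fin m ⊕ Fin n) :=
  {a | (∃ x : Fin m, a = Sum.inl x ∧ 1 ≤ (x : ℕ) ∧ (x : ℕ) < r) ∨
       (∃ y : Fin n, a = Sum.inr y ∧ 1 ≤ (y : ℕ) ∧ (y : ℕ) < r)}

/-- `a` and `b` both lie in `A` and are joined by a path of the induced subgraph of `G` on `A`. -/
def ReachIn {V : Type u} (G : SimpleGraph V) (A : Set V) (a b : V) : Prop :=
  ∃ (ha : a ∈ A) (hb : b ∈ A), (G.induce A).Reachable ⟨a, ha⟩ ⟨b, hb⟩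

/-- Auxiliary (connected case): `G[A]` has no cut vertex, or for every cut vertex `x`,
every connected component of `G[A] ∖ {x}` contains at most `r` cut vertices of `G[A] ∖ {x}`. -/
def RCutConnAux {V : Type u} (G : SimpleGraph V) (A : Set V) (r : ℕ) : Prop :=
  (∀ x, ¬ CutVertexOn G A x) ∨
    ∀ x, CutVertexOn G A x → ∀ a ∈ A \ {x},
      Set.ncard {w | CutVertexOn G (A \ {x}) w ∧ ReachIn G (A \ {x}) a w} ≤ r

/-- `G[A]` is `r`-cut-connected: every connected component of `G[A]` satisfies the
condition of `RCutConnAux`. -/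
def RCutConn {V : Type u} (G : SimpleGraph V) (A : Set V) (r : ℕ) : Prop :=
  ∀ a ∈ A, RCutConnAux G {b | ReachIn G A a b} r

/-- `G[A]` is strongly `r`-cut-connected: it is `r`-cut-connected and, recursively,
`G[A] ∖ {x}` is strongly `r`-cut-connected for every cut vertex `x`. -/
inductive StronglyRCutConn {V : Type u} (r : ℕ) : SimpleGraph V → Set V → Prop
  | mk (G : SimpleGraph V) (A : Set V) (h1 : RCutConn G A r)
      (h2 : ∀ x, CutVertexOn G A x → StronglyRCutConn r G (A \ {x})) :
      StronglyRCutConn r G A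

set_option linter.unusedSectionVars false

section Components

variable {V : Type*} {W : Type*}

/-- The vertex `t` has two neighbours in different connected components of `G[X]`. -/
def Reconn (G : SimpleGraph V) (X : Set V) (t : V) : Prop :=
  ∃ S : Set V, (∀ x ∈ X, ∀ y ∈ X, G.Adj x y → x ∈ S → y ∈ S) ∧
    (∃ a ∈ X, a ∈ S ∧ G.Adj t a) ∧ ∃ b ∈ X, b ∉ S ∧ G.Adj t b

theorem ReachIn.refl {G : SimpleGraph V} {X : Set V} {a : V} (ha : a ∈ X) : ReachIn G X a a :=
  ⟨ha, ha, Reachable.refl _⟩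

theorem ReachIn.symm {G : SimpleGraph V} {X : Set V} {a b : V} (h : ReachIn G X a b) :
    ReachIn G X b a := by
  obtain ⟨ha, hb, h⟩ := h
  exact ⟨hb, ha, h.symm⟩

theorem ReachIn.trans {G : SimpleGraph V} {X : Set V} {a b c : V} (h : ReachIn G X a b)
    (h' : ReachIn G X b c) : ReachIn G X a c := by
  obtain ⟨ha, hb, h⟩ := h
  obtain ⟨_, hc, h'⟩ := h'
  exact ⟨ha, hc, h.trans h'⟩

theorem ReachIn.of_adj {G : SimpleGraph V} {X : Set V} {a b : V} (ha : a ∈ X) (hb : b ∈ X)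
    (h : G.Adj a b) : ReachIn G X a b :=
  ⟨ha, hb, Adj.reachable (G := G.induce X) (u := ⟨a, ha⟩) (v := ⟨b, hb⟩) h⟩

theorem ReachIn.mem_of_closed {G : SimpleGraph V} {X S : Set V} {a b : V} (h : ReachIn G X a b)
    (hS : ∀ x ∈ X, ∀ y ∈ X, G.Adj x y → x ∈ S → y ∈ S) (ha : a ∈ S) : b ∈ S := by
  have key : ∀ {x y : X}, (G.induce X).Walk x y → (x : V) ∈ S → (y : V) ∈ S := by
    intro x y p
    induction p with
    | nil => exact id
    | cons e p ih => exact fun hx => ih (hS _ (Subtype.prop _) _ (Subtype.prop _) e hx)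
  obtain ⟨_, _, ⟨p⟩⟩ := h
  exact key p ha

theorem ReachIn.map {G : SimpleGraph V} {H : SimpleGraph W} {X : Set V} {Y : Set W} (f : V → W)
    (hf : ∀ x ∈ X, f x ∈ Y) (hadj : ∀ x ∈ X, ∀ y ∈ X, G.Adj x y → H.Adj (f x) (f y))
    {a b : V} (h : ReachIn G X a b) : ReachIn H Y (f a) (f b) := by
  have ha := h.1
  refine h.mem_of_closed (S := {b | ReachIn H Y (f a) (f b)}) ?_ (.refl (hf _ ha))
  exact fun x hx y hy hxy hax => hax.trans (.of_adj (hf _ hx) (hf _ hy) (hadj _ hx _ hy hxy))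

theorem ReachIn.mono {G H : SimpleGraph V} {X Y : Set V} (hXY : X ⊆ Y) (hGH : G ≤ H)
    {a b : V} (h : ReachIn G X a b) : ReachIn H Y a b :=
  h.map id hXY fun _ _ _ _ e => hGH e

theorem reconn_iff {G : SimpleGraph V} {X : Set V} {t : V} :
    Reconn G X t ↔ ∃ a ∈ X, ∃ b ∈ X, G.Adj t a ∧ G.Adj t b ∧ ¬ ReachIn G X a b := by
  constructor
  · rintro ⟨S, hS, ⟨a, ha, haS, hta⟩, b, hb, hbS, htb⟩
    exact ⟨a, ha, b, hb, hta, htb, fun h => hbS (h.mem_of_closed hS haS)⟩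
  · rintro ⟨a, ha, b, hb, hta, htb, h⟩
    exact ⟨{c | ReachIn G X a c}, fun x hx y hy hxy hax => hax.trans (.of_adj hx hy hxy),
      ⟨a, ha, .refl ha, hta⟩, b, hb, h, htb⟩

/-- Reconnecting in a union of components implies reconnecting in the whole set. -/
theorem Reconn.lift {G : SimpleGraph V} {X Y : Set V} {t : V} (h : Reconn G X t) (hXY : X ⊆ Y)
    (hcl : ∀ x ∈ X, ∀ y ∈ Y, G.Adj x y → y ∈ X) : Reconn G Y t := by
  obtain ⟨S, hS, ⟨a, ha, haS, hta⟩, b, hb, hbS, htb⟩ := h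
  refine ⟨S ∩ X, ?_, ⟨a, hXY ha, ⟨haS, ha⟩, hta⟩, b, hXY hb, fun h => hbS h.1, htb⟩
  intro x _ y hy hxy hx
  have := hcl x hx.2 y hy hxy
  exact ⟨hS x hx.2 y this hxy hx.1, this⟩

theorem Reconn.restrict {G : SimpleGraph V} {X Y : Set V} {t : V} (h : Reconn G Y t)
    (hXY : X ⊆ Y) (ht : ∀ y ∈ Y, G.Adj t y → y ∈ X) : Reconn G X t := by
  obtain ⟨S, hS, ⟨a, ha, haS, hta⟩, b, hb, hbS, htb⟩ := h
  exact ⟨S, fun x hx y hy => hS x (hXY hx) y (hXY hy), ⟨a, ht a ha hta, haS, hta⟩,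
    b, ht b hb htb, hbS, htb⟩

theorem ReachIn.of_insert {G : SimpleGraph V} {X : Set V} {x : V} (h : ¬ Reconn G X x)
    {a b : V} (ha : a ∈ X) (hb : b ∈ X) (hab : ReachIn G (insert x X) a b) :
    ReachIn G X a b := by
  by_contra hn
  let S : Set V := {c | ReachIn G X a c ∨ c = x ∧ ∃ d, ReachIn G X a d ∧ G.Adj x d}
  have hS : b ∈ S := by
    refine hab.mem_of_closed (S := S) ?_ (Or.inl (.refl ha))
    rintro y hy z hz hyz (hay | ⟨rfl, d, had, hd⟩)
    · rcases hz with rfl | hz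
      · exact Or.inr ⟨rfl, y, hay, hyz.symm⟩
      · exact Or.inl (hay.trans (.of_adj hay.2.1 hz hyz))
    · rcases hz with rfl | hz
      · exact absurd rfl hyz.ne
      · by_contra hnz
        exact h (reconn_iff.2 ⟨d, had.2.1, z, hz, hd, hyz,
          fun hdz => hnz (Or.inl (had.trans hdz))⟩)
  rcases hS with hS | ⟨rfl, d, had, hd⟩
  · exact hn hS
  · exact hn (had.trans (.of_adj had.2.1 hb hd.symm))

/-- Map on connected components induced by a map of vertex sets. -/
def compMap {G : SimpleGraph V} {H : SimpleGraph W} {X : Set V} {Y : Set W} (f : V → W)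
    (hf : ∀ x ∈ X, f x ∈ Y) (hadj : ∀ x ∈ X, ∀ y ∈ X, G.Adj x y → H.Adj (f x) (f y)) :
    (G.induce X).ConnectedComponent → (H.induce Y).ConnectedComponent :=
  ConnectedComponent.map ⟨fun x => ⟨f x, hf x x.2⟩, fun {a b} e => hadj a a.2 b b.2 e⟩

theorem compMap_injective {G : SimpleGraph V} {H : SimpleGraph W} {X : Set V} {Y : Set W}
    (f : V → W) (hf : ∀ x ∈ X, f x ∈ Y)
    (hadj : ∀ x ∈ X, ∀ y ∈ X, G.Adj x y → H.Adj (f x) (f y))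
    (hinj : ∀ a ∈ X, ∀ b ∈ X, ReachIn H Y (f a) (f b) → ReachIn G X a b) :
    Function.Injective (compMap (G := G) (H := H) f hf hadj) := by
  intro c d
  refine ConnectedComponent.ind₂ (fun a b h => ?_) c d
  obtain ⟨_, _, h⟩ := hinj a a.2 b b.2 ⟨hf a a.2, hf b b.2, ConnectedComponent.exact h⟩
  exact ConnectedComponent.sound h

theorem compMap_surjective {G : SimpleGraph V} {H : SimpleGraph W} {X : Set V} {Y : Set W}
    (f : V → W) (hf : ∀ x ∈ X, f x ∈ Y)
    (hadj : ∀ x ∈ X, ∀ y ∈ X, G.Adj x y → H.Adj (f x) (f y))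
    (hsurj : ∀ y ∈ Y, ∃ x ∈ X, ReachIn H Y (f x) y) :
    Function.Surjective (compMap (G := G) (H := H) f hf hadj) := by
  intro d
  refine ConnectedComponent.ind (fun b => ?_) d
  obtain ⟨x, hx, _, _, h⟩ := hsurj b b.2
  exact ⟨(G.induce X).connectedComponentMk ⟨x, hx⟩, ConnectedComponent.sound h⟩

theorem cComp_le_of_injective [Finite W] {G : SimpleGraph V} {H : SimpleGraph W} {X : Set V}
    {Y : Set W} (f : V → W) (hf : ∀ x ∈ X, f x ∈ Y)
    (hadj : ∀ x ∈ X, ∀ y ∈ X, G.Adj x y → H.Adj (f x) (f y))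
    (hinj : ∀ a ∈ X, ∀ b ∈ X, ReachIn H Y (f a) (f b) → ReachIn G X a b) :
    cComp G X ≤ cComp H Y :=
  Nat.card_le_card_of_injective _ (compMap_injective f hf hadj hinj)

variable [Finite V]

instance finite_components (G : SimpleGraph V) (X : Set V) :
    Finite (G.induce X).ConnectedComponent := Quot.finite _

theorem cComp_le_of_surjective {G : SimpleGraph V} {H : SimpleGraph W} {X : Set V}
    {Y : Set W} (f : V → W) (hf : ∀ x ∈ X, f x ∈ Y)
    (hadj : ∀ x ∈ X, ∀ y ∈ X, G.Adj x y → H.Adj (f x) (f y))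
    (hsurj : ∀ y ∈ Y, ∃ x ∈ X, ReachIn H Y (f x) y) :
    cComp H Y ≤ cComp G X :=
  Nat.card_le_card_of_surjective _ (compMap_surjective f hf hadj hsurj)

theorem cComp_eq_of_bijective [Finite W] {G : SimpleGraph V} {H : SimpleGraph W} {X : Set V}
    {Y : Set W} (f : V → W) (hf : ∀ x ∈ X, f x ∈ Y)
    (hadj : ∀ x ∈ X, ∀ y ∈ X, G.Adj x y → H.Adj (f x) (f y))
    (hinj : ∀ a ∈ X, ∀ b ∈ X, ReachIn H Y (f a) (f b) → ReachIn G X a b)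
    (hsurj : ∀ y ∈ Y, ∃ x ∈ X, ReachIn H Y (f x) y) :
    cComp G X = cComp H Y :=
  (cComp_le_of_injective f hf hadj hinj).antisymm (cComp_le_of_surjective f hf hadj hsurj)

theorem cComp_union_le (G : SimpleGraph V) (X Y : Set V) :
    cComp G (X ∪ Y) ≤ cComp G X + cComp G Y := by
  rw [cComp, cComp, cComp, ← Nat.card_sum]
  refine Nat.card_le_card_of_surjective
    (Sum.elim (compMap (H := G) id (fun x hx => Or.inl hx) fun _ _ _ _ e => e)
      (compMap (H := G) id (fun x hx => Or.inr hx) fun _ _ _ _ e => e)) ?_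
  intro d
  refine ConnectedComponent.ind (fun b => ?_) d
  obtain ⟨b, hb | hb⟩ := b
  · exact ⟨Sum.inl ((G.induce X).connectedComponentMk ⟨b, hb⟩), rfl⟩
  · exact ⟨Sum.inr ((G.induce Y).connectedComponentMk ⟨b, hb⟩), rfl⟩

theorem cComp_union {G : SimpleGraph V} {X Y : Set V} (hd : Disjoint X Y)
    (hXY : ∀ x ∈ X, ∀ y ∈ Y, ¬ G.Adj x y) : cComp G (X ∪ Y) = cComp G X + cComp G Y := by
  refine (cComp_union_le G X Y).antisymm ?_
  have key : ∀ {a b : V}, ReachIn G (X ∪ Y) a b → (a ∈ X → ReachIn G X a b) ∧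
      (a ∈ Y → ReachIn G Y a b) := by
    intro a b h
    constructor
    · intro ha
      refine h.mem_of_closed (S := {b | ReachIn G X a b}) ?_ (.refl ha)
      rintro x - y (hy | hy) e hx
      · exact hx.trans (.of_adj hx.2.1 hy e)
      · exact absurd e (hXY _ hx.2.1 _ hy)
    · intro ha
      refine h.mem_of_closed (S := {b | ReachIn G Y a b}) ?_ (.refl ha)
      rintro x - y (hy | hy) e hx
      · exact absurd e.symm (hXY _ hy _ hx.2.1)
      · exact hx.trans (.of_adj hx.2.1 hy e)
  rw [cComp, cComp, cComp, ← Nat.card_sum]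
  refine Nat.card_le_card_of_injective
    (Sum.elim (compMap (H := G) id (fun x hx => Or.inl hx) fun _ _ _ _ e => e)
      (compMap (H := G) id (fun x hx => Or.inr hx) fun _ _ _ _ e => e)) ?_
  refine Function.Injective.sumElim (compMap_injective _ _ _ fun a ha b _ h => (key h).1 ha)
    (compMap_injective _ _ _ fun a ha b _ h => (key h).2 ha) ?_
  intro c d
  refine ConnectedComponent.ind (fun a => ?_) c
  refine ConnectedComponent.ind (fun b h => ?_) d
  have h' : ReachIn G (X ∪ Y) a b :=
    ⟨Or.inl a.2, Or.inr b.2, ConnectedComponent.exact h⟩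
  exact hd.le_bot ⟨((key h').1 a.2).2.1, b.2⟩

theorem cComp_le_ncard (G : SimpleGraph V) (X : Set V) : cComp G X ≤ X.ncard :=
  Nat.card_le_card_of_surjective (G.induce X).connectedComponentMk Quot.mk_surjective

theorem one_le_cComp (G : SimpleGraph V) {X : Set V} (h : X.Nonempty) : 1 ≤ cComp G X := by
  have : Nonempty (G.induce X).ConnectedComponent :=
    ⟨(G.induce X).connectedComponentMk ⟨_, h.some_mem⟩⟩
  exact Nat.card_pos

theorem cComp_eq_one_of_reach {G : SimpleGraph V} {X : Set V} {a : V} (ha : a ∈ X)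
    (h : ∀ b ∈ X, ReachIn G X a b) : cComp G X = 1 := by
  refine le_antisymm ?_ (one_le_cComp G ⟨a, ha⟩)
  refine (cComp_le_of_surjective (X := {a}) (G := G) id (by simpa) (by simp) ?_).trans
    ((cComp_le_ncard G {a}).trans (by simp))
  exact fun y hy => ⟨a, rfl, h y hy⟩

theorem cComp_insert_le {G : SimpleGraph V} {X : Set V} {x y : V} (hy : y ∈ X)
    (h : G.Adj x y) : cComp G (insert x X) ≤ cComp G X := by
  refine cComp_le_of_surjective id (fun a ha => Or.inr ha) (fun _ _ _ _ e => e) ?_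
  rintro z (rfl | hz)
  · exact ⟨y, hy, .of_adj (Or.inr hy) (Or.inl rfl) h.symm⟩
  · exact ⟨z, hz, .refl (Or.inr hz)⟩

theorem cComp_le_insert {G : SimpleGraph V} {X : Set V} {x : V} (h : ¬ Reconn G X x) :
    cComp G X ≤ cComp G (insert x X) :=
  cComp_le_of_injective id (fun _ ha => Or.inr ha) (fun _ _ _ _ e => e)
    fun _ ha _ hb => .of_insert h ha hb

theorem cComp_insert_lt {G : SimpleGraph V} {X : Set V} {x : V} (h : Reconn G X x) :
    cComp G (insert x X) < cComp G X := by
  obtain ⟨a, ha, b, hb, hxa, hxb, hab⟩ := reconn_iff.1 h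
  have hsurj : Function.Surjective (compMap (G := G) (H := G) (X := X) (Y := insert x X) id
      (fun a ha => Or.inr ha) (fun _ _ _ _ e => e)) := by
    refine compMap_surjective _ _ _ ?_
    rintro z (rfl | hz)
    · exact ⟨a, ha, .of_adj (Or.inr ha) (Or.inl rfl) hxa.symm⟩
    · exact ⟨z, hz, .refl (Or.inr hz)⟩
  refine lt_of_le_of_ne (Nat.card_le_card_of_surjective _ hsurj) fun heq => hab ?_
  have hbij := (Nat.bijective_iff_surjective_and_card _).2 ⟨hsurj, heq.symm⟩
  have h1 : ReachIn G (insert x X) a b :=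
    (ReachIn.of_adj (Set.mem_insert_of_mem x ha) (Set.mem_insert x X) hxa.symm).trans
      (.of_adj (Set.mem_insert x X) (Set.mem_insert_of_mem x hb) hxb)
  have := hbij.1 (a₁ := (G.induce X).connectedComponentMk ⟨a, ha⟩)
    (a₂ := (G.induce X).connectedComponentMk ⟨b, hb⟩) (ConnectedComponent.sound h1.2.2)
  exact ⟨ha, hb, ConnectedComponent.exact this⟩

theorem cutVertexOn_iff {G : SimpleGraph V} {A : Set V} {x : V} :
    CutVertexOn G A x ↔ x ∈ A ∧ Reconn G (A \ {x}) x := by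
  refine and_congr_right fun hx => ?_
  have hA : insert x (A \ {x}) = A := by rw [Set.insert_sdiff_singleton, Set.insert_eq_of_mem hx]
  constructor
  · intro h
    by_contra hn
    have := cComp_le_insert hn
    rw [hA] at this
    omega
  · intro h
    have := cComp_insert_lt h
    rwa [hA] at this

theorem cutsetOn_iff [DecidableEq V] {G : SimpleGraph V} {A : Set V} {T : Finset V} :
    CutsetOn G A T ↔ ↑T ⊆ A ∧ ∀ t ∈ T, Reconn G (A \ ↑T) t := by
  refine and_congr_right fun hT => forall₂_congr fun t ht => ?_
  have h : (A \ ↑(T.erase t)) \ {t} = A \ ↑T := by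
    ext y
    simp only [Set.mem_sdiff, Finset.mem_coe, Finset.mem_erase, Set.mem_singleton_iff]
    grind
  rw [cutVertexOn_iff, h]
  refine and_iff_right ⟨hT ht, by simp⟩

end Components
section Core

variable {W : Type*}

/-- Cutsets of the whole graph, phrased for arbitrary sets of vertices. -/
def Cut (G : SimpleGraph W) (T : Set W) : Prop := ∀ t ∈ T, Reconn G Tᶜ t

/-- Connected graphs that are accessible. -/
structure ConnAccessible (G : SimpleGraph W) : Prop where
  conn : ∀ S : Set W, S.Nonempty → (∀ a ∈ S, ∀ b, G.Adj a b → b ∈ S) → ∀ b, b ∈ S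
  unmixed : ∀ T, Cut G T → cComp G Tᶜ = T.ncard + 1
  acc : ∀ T, Cut G T → T.Nonempty → ∃ t ∈ T, Cut G (T \ {t})

/-- `K` is a component of the complement of the cut vertex `x`, and `T` is a cutset of `G[K]`
containing all neighbours of `x` in `K`. -/
structure BadAt (G : SimpleGraph W) (x : W) (K T : Set W) : Prop where
  notMem : x ∉ K
  closed : ∀ a ∈ K, ∀ b, G.Adj a b → b ≠ x → b ∈ K
  adj_mem : ∃ a ∈ K, G.Adj x a
  adj_notMem : ∃ b, b ∉ K ∧ G.Adj x b
  subset : T ⊆ K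
  nbr : ∀ a ∈ K, G.Adj x a → a ∈ T
  reconn : ∀ t ∈ T, Reconn G (K \ T) t

theorem cut_of_separation {G : SimpleGraph W} {T : Set W} (D : Set W)
    (hcl : ∀ a ∈ D, ∀ b, G.Adj a b → b ∈ D ∨ b ∈ T)
    (h : ∀ t ∈ T, (∃ a ∈ D, a ∉ T ∧ G.Adj t a) ∧ ∃ b, b ∉ D ∧ b ∉ T ∧ G.Adj t b) : Cut G T := by
  intro t ht
  obtain ⟨⟨a, ha, haT, hta⟩, b, hb, hbT, htb⟩ := h t ht
  exact ⟨D, fun x _ y hy e hx => (hcl x hx y e).resolve_right hy, ⟨a, haT, ha, hta⟩, b, hbT, hb, htb⟩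

variable [Finite W] {G : SimpleGraph W}

theorem ConnAccessible.exists_subset (hG : ConnAccessible G) {T : Set W} (hT : Cut G T) {k : ℕ}
    (hk : k ≤ T.ncard) : ∃ S ⊆ T, S.ncard = k ∧ Cut G S := by
  induction h : T.ncard - k generalizing T with
  | zero => exact ⟨T, subset_rfl, by omega, hT⟩
  | succ n ih =>
    obtain ⟨t, ht, hTt⟩ := hG.acc T hT (Set.nonempty_of_ncard_ne_zero (by omega))
    have := Set.ncard_sdiff_singleton_of_mem ht
    obtain ⟨S, hS, h'⟩ := ih hTt (by omega) (by omega)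
    exact ⟨S, hS.trans Set.sdiff_subset, h'⟩

theorem ConnAccessible.exists_cutVertex (hG : ConnAccessible G) {T : Set W} (hT : Cut G T)
    (hne : T.Nonempty) : ∃ x ∈ T, Cut G {x} := by
  obtain ⟨S, hS, hc, hcut⟩ := hG.exists_subset hT (k := 1) ((Set.ncard_pos).2 hne)
  obtain ⟨x, rfl⟩ := Set.ncard_eq_one.1 hc
  exact ⟨x, hS rfl, hcut⟩

theorem ConnAccessible.exists_pair (hG : ConnAccessible G) {T : Set W} (hT : Cut G T)
    (h2 : 2 ≤ T.ncard) : ∃ x ∈ T, ∃ y ∈ T, x ≠ y ∧ Cut G {x} ∧ Cut G {x, y} := by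
  obtain ⟨S, hS, hc, hcut⟩ := hG.exists_subset hT h2
  obtain ⟨x, y, hxy, rfl⟩ := Set.ncard_eq_two.1 hc
  obtain ⟨z, rfl | rfl, hz⟩ := hG.exists_cutVertex hcut ⟨x, by simp⟩
  · exact ⟨z, hS (by simp), y, hS (by simp), hxy, hz, hcut⟩
  · exact ⟨z, hS (by simp), x, hS (by simp), hxy.symm, hz, by rwa [Set.pair_comm]⟩

/-- The boundary of the set of vertices outside the closed neighbourhood of `Y` is a cutset. -/
theorem ConnAccessible.exists_boundary (hG : ConnAccessible G) {Y : Set W} (hY : Y.Nonempty) {w : W}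
    (hw : w ∉ Y) (hwY : ∀ y ∈ Y, ¬ G.Adj y w) :
    ∃ T D : Set W, Cut G T ∧ T.Nonempty ∧ w ∈ D ∧ Disjoint D Y ∧ Disjoint T Y ∧
      (∀ t ∈ T, ∃ y ∈ Y, G.Adj y t) ∧ ∀ a ∈ D, ∀ b, G.Adj a b → b ∈ D ∨ b ∈ T := by
  let D : Set W := {d | d ∉ Y ∧ ∀ y ∈ Y, ¬ G.Adj y d}
  let T : Set W := {t | t ∉ D ∧ ∃ d ∈ D, G.Adj d t}
  have hTY : ∀ t ∈ T, t ∉ Y ∧ ∃ y ∈ Y, G.Adj y t := by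
    rintro t ⟨ht, d, hd, hdt⟩
    have h1 : t ∉ Y := fun h => hd.2 t h hdt.symm
    refine ⟨h1, ?_⟩
    by_contra! hn
    exact ht ⟨h1, hn⟩
  have hcl : ∀ a ∈ D, ∀ b, G.Adj a b → b ∈ D ∨ b ∈ T := by
    intro a ha b hab
    by_cases hb : b ∈ D
    · exact Or.inl hb
    · exact Or.inr ⟨hb, a, ha, hab⟩
  have hDY : Disjoint D Y := Set.disjoint_left.2 fun d hd => hd.1
  refine ⟨T, D, cut_of_separation D hcl ?_, ?_, ⟨hw, hwY⟩, hDY,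
    Set.disjoint_left.2 fun t ht => (hTY t ht).1, fun t ht => (hTY t ht).2, hcl⟩
  · rintro t ht
    obtain ⟨d, hd, hdt⟩ := ht.2
    obtain ⟨y, hy, hyt⟩ := (hTY t ht).2
    exact ⟨⟨d, hd, fun h => h.1 hd, hdt.symm⟩, y, fun h => h.1 hy, fun h => (hTY y h).1 hy, hyt.symm⟩
  · by_contra hT
    rw [Set.not_nonempty_iff_eq_empty] at hT
    obtain ⟨y, hy⟩ := hY
    refine (hG.conn D ⟨w, hw, hwY⟩ (fun a ha b hab => ?_) y).1 hy
    have := hcl a ha b hab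
    rwa [hT, Set.mem_empty_iff_false, or_false] at this

theorem ConnAccessible.exists_cutVertex_adj (hG : ConnAccessible G) {Y : Set W} (hY : Y.Nonempty)
    {w : W} (hw : w ∉ Y) (hwY : ∀ y ∈ Y, ¬ G.Adj y w) :
    ∃ z, Cut G {z} ∧ z ∉ Y ∧ ∃ y ∈ Y, G.Adj y z := by
  obtain ⟨T, D, hT, hne, -, -, hTY, hadj, -⟩ := hG.exists_boundary hY hw hwY
  obtain ⟨z, hz, hcz⟩ := hG.exists_cutVertex hT hne
  exact ⟨z, hcz, Set.disjoint_left.1 hTY hz, hadj z hz⟩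

theorem ConnAccessible.exists_adj_cutVertex (hG : ConnAccessible G) {x v : W} (hv : Cut G {v})
    (hxv : x ≠ v) : ∃ z, Cut G {z} ∧ G.Adj x z := by
  by_cases h : G.Adj x v
  · exact ⟨v, hv, h⟩
  · obtain ⟨z, hz, -, y, rfl, hyz⟩ :=
      hG.exists_cutVertex_adj (Y := {x}) ⟨x, rfl⟩ (w := v) (by simpa using hxv.symm) (by simpa)
    exact ⟨z, hz, hyz⟩

namespace BadAt

variable {x : W} {K T : Set W}

/-- The side of `x` opposite to `K`. -/
def other (x : W) (K : Set W) : Set W := {y | y ∉ K ∧ y ≠ x}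

theorem other_closed (h : BadAt G x K T) {a b : W} (ha : a ∈ other x K) (hab : G.Adj a b)
    (hb : b ≠ x) : b ∈ other x K :=
  ⟨fun hbK => ha.1 (h.closed b hbK a hab.symm ha.2), hb⟩

theorem other_nonempty (h : BadAt G x K T) : ∃ b ∈ other x K, G.Adj x b := by
  obtain ⟨b, hb, e⟩ := h.adj_notMem
  exact ⟨b, ⟨hb, e.ne'⟩, e⟩

theorem cut_singleton (h : BadAt G x K T) : Cut G {x} := by
  refine cut_of_separation K (fun a ha b hab => ?_) ?_
  · by_cases hb : b = x
    · exact Or.inr hb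
    · exact Or.inl (h.closed a ha b hab hb)
  · rintro t rfl
    obtain ⟨a, ha, e⟩ := h.adj_mem
    obtain ⟨b, hb, e'⟩ := h.adj_notMem
    exact ⟨⟨a, ha, e.ne', e⟩, b, hb, e'.ne', e'⟩

theorem cut (h : BadAt G x K T) : Cut G T := by
  intro t ht
  refine (h.reconn t ht).lift (fun a ha => ha.2) fun a ha b hb hab => ⟨?_, hb⟩
  exact h.closed a ha.1 b hab fun hbx => ha.2 (h.nbr a ha.1 (hbx ▸ hab.symm))

theorem cut_insert_of_other (h : BadAt G x K T) {S : Set W} (hS : S ⊆ other x K)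
    (hSr : ∀ s ∈ S, Reconn G (other x K \ S) s) (hx : Reconn G (other x K \ S) x) :
    Cut G (insert x S) := by
  rintro t ht
  refine Reconn.lift (X := other x K \ S) ?_ ?_ ?_
  · rcases ht with rfl | ht
    exacts [hx, hSr t ht]
  · rintro a ⟨ha, haS⟩ (rfl | h')
    exacts [ha.2 rfl, haS h']
  · rintro a ⟨ha, haS⟩ b hb hab
    exact ⟨h.other_closed ha hab fun e => hb (Or.inl e), fun e => hb (Or.inr e)⟩

theorem cut_union (h : BadAt G x K T) {S : Set W} (hS : S ⊆ other x K)
    (hSr : ∀ s ∈ S, Reconn G (other x K \ S) s) (hx : Reconn G (other x K \ S) x) :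
    Cut G (T ∪ insert x S) := by
  rintro t ht
  by_cases htT : t ∈ T
  · refine (h.reconn t htT).lift ?_ ?_
    · rintro a ⟨ha, haT⟩ (h' | rfl | h')
      exacts [haT h', h.notMem ha, (hS h').1 ha]
    · rintro a ⟨ha, haT⟩ b hb hab
      exact ⟨h.closed a ha b hab fun e => hb (Or.inr (Or.inl e)), fun e => hb (Or.inl e)⟩
  · refine Reconn.lift (X := other x K \ S) ?_ ?_ ?_
    · rcases ht.resolve_left htT with rfl | ht
      exacts [hx, hSr t ht]
    · rintro a ⟨ha, haS⟩ (h' | rfl | h')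
      exacts [ha.1 (h.subset h'), ha.2 rfl, haS h']
    · rintro a ⟨ha, haS⟩ b hb hab
      exact ⟨h.other_closed ha hab fun e => hb (Or.inr (Or.inl e)),
        fun e => hb (Or.inr (Or.inr e))⟩

theorem not_adj_other (h : BadAt G x K T) {a b : W} (ha : a ∈ K) (hb : b ∈ other x K) :
    ¬ G.Adj a b := fun e => hb.1 (h.closed a ha b e hb.2)

theorem cComp_eq_one (h : BadAt G x K T) (hG : ConnAccessible G) :
    cComp G K = 1 ∧ cComp G (other x K) = 1 := by
  have h2 := hG.unmixed _ h.cut_singleton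
  have hun : ({x}ᶜ : Set W) = K ∪ other x K := by
    ext y
    simp only [Set.mem_compl_iff, Set.mem_singleton_iff, Set.mem_union, other, Set.mem_ofPred_eq]
    constructor
    · tauto
    · rintro (hy | hy) rfl
      exacts [h.notMem hy, hy.2 rfl]
  rw [hun, cComp_union (Set.disjoint_left.2 fun a ha hb => hb.1 ha)
    (fun a ha b hb => h.not_adj_other ha hb), Set.ncard_singleton] at h2
  obtain ⟨a, ha, -⟩ := h.adj_mem
  obtain ⟨b, hb, -⟩ := h.other_nonempty
  have := one_le_cComp G ⟨a, ha⟩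
  have := one_le_cComp G ⟨b, hb⟩
  omega

theorem not_reconn_other (h : BadAt G x K T) (hG : ConnAccessible G) {S : Set W}
    (hS : S ⊆ other x K) (hSr : ∀ s ∈ S, Reconn G (other x K \ S) s) :
    ¬ Reconn G (other x K \ S) x := by
  intro hx
  have e1 := hG.unmixed _ h.cut
  have e2 := hG.unmixed _ (h.cut_insert_of_other hS hSr hx)
  have e3 := hG.unmixed _ (h.cut_union hS hSr hx)
  have hxS : x ∉ S := fun hxS => (hS hxS).2 rfl
  have hdisj : Disjoint T (insert x S) := by
    refine Set.disjoint_left.2 fun t ht => ?_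
    rintro (rfl | h')
    exacts [h.notMem (h.subset ht), (hS h').1 (h.subset ht)]
  have s1 : Tᶜ = (K \ T) ∪ insert x (other x K) := by
    ext y
    have := @h.subset y
    simp only [Set.mem_compl_iff, Set.mem_union, Set.mem_sdiff, Set.mem_insert_iff, other,
      Set.mem_ofPred_eq]
    by_cases hy : y = x
    · have := h.notMem
      grind
    · grind
  have s2 : (insert x S)ᶜ = K ∪ (other x K \ S) := by
    ext y
    have := @hS y
    have := h.notMem
    simp only [Set.mem_compl_iff, Set.mem_union, Set.mem_sdiff, Set.mem_insert_iff, other,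
      Set.mem_ofPred_eq] at *
    grind
  have s3 : (T ∪ insert x S)ᶜ = (K \ T) ∪ (other x K \ S) := by
    ext y
    have := @hS y
    have := @h.subset y
    have := h.notMem
    simp only [Set.mem_compl_iff, Set.mem_union, Set.mem_sdiff, Set.mem_insert_iff, other,
      Set.mem_ofPred_eq] at *
    grind
  rw [s1, cComp_union] at e1
  · rw [s2, cComp_union, Set.ncard_insert_of_notMem hxS] at e2
    · rw [s3, Set.ncard_union_eq hdisj, Set.ncard_insert_of_notMem hxS] at e3
      have := cComp_union_le G (K \ T) (other x K \ S)
      obtain ⟨a, ha, -⟩ := h.adj_mem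
      have := one_le_cComp G ⟨a, ha⟩
      have := one_le_cComp G ⟨x, Set.mem_insert x (other x K)⟩
      omega
    · exact Set.disjoint_left.2 fun a ha hb => hb.1.1 ha
    · exact fun a ha b hb => h.not_adj_other ha hb.1
  · refine Set.disjoint_left.2 fun a ha => ?_
    rintro (rfl | hb)
    exacts [h.notMem ha.1, hb.1 ha.1]
  · rintro a ha b (rfl | hb) e
    exacts [ha.2 (h.nbr a ha.1 e.symm), h.not_adj_other ha.1 hb e]

theorem false_of_nbr_region (h : BadAt G x K T) {p : W} {R : Set W} (hRK : R ⊆ K)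
    (hne : R.Nonempty) (hRx : ∀ r ∈ R, G.Adj x r)
    (hcl : ∀ r ∈ R, ∀ b ∈ K, G.Adj r b → b ∈ R ∨ b = p) : False := by
  obtain ⟨r, hr⟩ := hne
  have hRT : ∀ r ∈ R, r ∈ T := fun r hr => h.nbr r (hRK hr) (hRx r hr)
  obtain ⟨S, -, ⟨a, ha, haS, hra⟩, b, hb, hbS, hrb⟩ := h.reconn r (hRT r hr)
  have e1 := (hcl r hr a ha.1 hra).resolve_left fun h' => ha.2 (hRT a h')
  have e2 := (hcl r hr b hb.1 hrb).resolve_left fun h' => hb.2 (hRT b h')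
  exact hbS (e2 ▸ e1 ▸ haS)

theorem exists_cutVertex (h : BadAt G x K T) (hG : ConnAccessible G) :
    ∃ y ∈ K, Cut G {y} := by
  obtain ⟨a, ha, e⟩ := h.adj_mem
  obtain ⟨y, hy, hc⟩ := hG.exists_cutVertex h.cut ⟨a, h.nbr a ha e⟩
  exact ⟨y, h.subset hy, hc⟩

end BadAt

end Core
section BadStars

variable {W : Type*}

/-- The vertices lying in all the chosen sides `K x`, for `x ∈ B`. -/
def middle (B : Set W) (K : W → Set W) : Set W := {m | ∀ x ∈ B, m ∈ K x}

/-- A family of bad cut vertices facing each other, with no other cut vertex in the middle. -/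
structure BadStar (G : SimpleGraph W) (B : Set W) (K T : W → Set W) : Prop where
  bad : ∀ x ∈ B, BadAt G x (K x) (T x)
  mem : ∀ x ∈ B, ∀ y ∈ B, x ≠ y → y ∈ K x
  not_cut : ∀ m ∈ middle B K, ¬ Cut G {m}

theorem cComp_biUnion_le [Finite W] (G : SimpleGraph W) (B : Set W) (f : W → Set W)
    (h : ∀ x ∈ B, cComp G (f x) ≤ 1) : cComp G (⋃ x ∈ B, f x) ≤ B.ncard := by
  induction B, B.toFinite using Set.Finite.induction_on with
  | empty => 
    have := cComp_le_ncard G (⋃ x ∈ (∅ : Set W), f x)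
    simpa using this
  | @insert a s ha hs ih =>
    rw [Set.biUnion_insert, Set.ncard_insert_of_notMem ha]
    have h1 := cComp_union_le G (f a) (⋃ x ∈ s, f x)
    have h2 := h a (Set.mem_insert a s)
    have h3 := ih fun x hx => h x (Set.mem_insert_of_mem a hx)
    omega

variable [Finite W] {G : SimpleGraph W}

theorem BadAt.eq_of_closed {x : W} {K T R : Set W} (h : BadAt G x K T) (hG : ConnAccessible G)
    (hRK : R ⊆ K) (hne : R.Nonempty) (hcl : ∀ a ∈ R, ∀ b ∈ K, G.Adj a b → b ∈ R) : R = K := by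
  by_contra hn
  obtain ⟨b, hb, hbR⟩ := Set.exists_of_ssubset (hRK.ssubset_of_ne hn)
  have h1 := (h.cComp_eq_one hG).1
  rw [← Set.union_sdiff_cancel hRK, cComp_union Set.disjoint_sdiff_right
    fun a ha b hb e => hb.2 (hcl a ha b hb.1 e)] at h1
  have := one_le_cComp G hne
  have := one_le_cComp G (X := K \ R) ⟨b, hb, hbR⟩
  omega

namespace BadStar

open BadAt

variable {B : Set W} {K T : W → Set W}

theorem other_subset (h : BadStar G B K T) (hG : ConnAccessible G) {x y : W} (hx : x ∈ B) (hy : y ∈ B)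
    (hxy : x ≠ y) : other x (K x) ⊆ K y := by
  intro o ho
  by_contra hn
  have hoy : o ≠ y := fun e => ho.1 (e ▸ h.mem x hx y hy hxy)
  refine (hG.conn (other x (K x) ∩ other y (K y)) ⟨o, ho, hn, hoy⟩ ?_ x).1.2 rfl
  rintro a ⟨hax, hay⟩ b hab
  refine ⟨(h.bad x hx).other_closed hax hab ?_, (h.bad y hy).other_closed hay hab ?_⟩
  · rintro rfl
    exact (h.bad y hy).not_adj_other (h.mem y hy b hx hxy.symm) hay hab.symm
  · rintro rfl
    exact (h.bad x hx).not_adj_other (h.mem x hx b hy hxy) hax hab.symm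

theorem notMem_of_middle (h : BadStar G B K T) {m : W} (hm : m ∈ middle B K) : m ∉ B :=
  fun hmB => (h.bad m hmB).notMem (hm m hmB)

theorem mem_or_other (y : W) : y ∈ middle B K ∪ B ∨ ∃ x ∈ B, y ∈ other x (K x) := by
  by_cases hy : y ∈ B
  · exact Or.inl (Or.inr hy)
  by_cases hm : y ∈ middle B K
  · exact Or.inl (Or.inl hm)
  · simp only [middle, Set.mem_ofPred_eq, not_forall] at hm
    obtain ⟨x, hx, hyx⟩ := hm
    exact Or.inr ⟨x, hx, hyx, fun e => hy (e ▸ hx)⟩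

theorem notMem_other (h : BadStar G B K T) {x y : W} (hy : y ∈ middle B K ∪ B) (hx : x ∈ B) :
    y ∉ other x (K x) := by
  rintro ⟨h1, h2⟩
  rcases hy with hy | hy
  exacts [h1 (hy x hx), h1 (h.mem x hx y hy h2.symm)]

theorem nbr_middle (h : BadStar G B K T) {m b : W} (hm : m ∈ middle B K) (e : G.Adj m b) :
    b ∈ middle B K ∪ B := by
  rcases mem_or_other (B := B) (K := K) b with hb | ⟨x, hx, hb⟩
  · exact hb
  · exact absurd e ((h.bad x hx).not_adj_other (hm x hx) hb)

theorem nbr_boundary (h : BadStar G B K T) {x b : W} (hx : x ∈ B) (e : G.Adj x b)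
    (hb : b ∉ other x (K x)) : b ∈ middle B K ∪ B := by
  rcases mem_or_other (B := B) (K := K) b with hb' | ⟨y, hy, hb'⟩
  · exact hb'
  · rcases eq_or_ne x y with rfl | hxy
    · exact absurd hb' hb
    · exact absurd e ((h.bad y hy).not_adj_other (h.mem y hy x hx hxy.symm) hb')

theorem exists_adj_of_middle (h : BadStar G B K T) (hG : ConnAccessible G) (hB : B.Nonempty) {m : W}
    (hm : m ∈ middle B K) : ∃ x ∈ B, G.Adj m x := by
  obtain ⟨x, hx⟩ := hB
  obtain ⟨z, hz, e⟩ := hG.exists_adj_cutVertex (x := m) (h.bad x hx).cut_singleton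
    (fun e => h.notMem_of_middle hm (e ▸ hx))
  exact ⟨z, (h.nbr_middle hm e).resolve_left fun hzm => h.not_cut z hzm hz, e⟩

theorem exists_nbr_notMem (h : BadStar G B K T) (hG : ConnAccessible G) {u v : W} (hu : u ∈ B)
    (hv : v ∈ B) (hvT : v ∈ T u) :
    ∃ n ∈ middle B K ∪ B, G.Adj v n ∧ n ∉ T u ∧ n ≠ u := by
  by_contra! hn
  have hb := h.bad u hu
  have huv : v ≠ u := fun e => hb.notMem (e ▸ hb.subset hvT)
  have hsub := h.other_subset hG hv hu huv
  refine (h.bad v hv).not_reconn_other hG (S := T u ∩ other v (K v)) Set.inter_subset_right ?_ ?_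
  · rintro s ⟨hs, hso⟩
    refine (hb.reconn s hs).restrict (fun a ha => ⟨hsub ha.1, fun h' => ha.2 ⟨h', ha.1⟩⟩) ?_
    intro y hy e
    exact ⟨(h.bad v hv).other_closed hso e fun e' => hy.2 (e' ▸ hvT), fun h' => hy.2 h'.1⟩
  · refine (hb.reconn v hvT).restrict (fun a ha => ⟨hsub ha.1, fun h' => ha.2 ⟨h', ha.1⟩⟩) ?_
    intro y hy e
    refine ⟨?_, fun h' => hy.2 h'.1⟩
    by_contra hyo
    exact hb.notMem (hn y (h.nbr_boundary hv e hyo) e hy.2 ▸ hy.1)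

theorem cut_inter (h : BadStar G B K T) (hG : ConnAccessible G) {u : W} (hu : u ∈ B) :
    Cut G (T u ∩ (middle B K ∪ B)) := by
  have hb := h.bad u hu
  rintro t ⟨ht, htm | htB⟩
  · obtain ⟨S, hS, ⟨a, ha, haS, ea⟩, b, hbX, hbS, eb⟩ := hb.reconn t ht
    refine ⟨{y | y ∈ middle B K ∪ B ∧ y ∈ S ∧ y ∈ K u \ T u} ∪
      {y | ∃ v ∈ B, y ∈ other v (K v) ∧ v ∈ S ∧ v ∈ K u \ T u}, ?_,
      ⟨a, fun h' => ha.2 h'.1, Or.inl ⟨h.nbr_middle htm ea, haS, ha⟩, ea⟩,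
      b, fun h' => hbX.2 h'.1, ?_, eb⟩
    · rintro x - y hyT e hx
      have key : x ∈ S → x ∈ K u \ T u → y ∈ middle B K ∪ B → y ∈ S ∧ y ∈ K u \ T u := by
        intro hxS hxK hy
        have hyK : y ∈ K u \ T u := ⟨hb.closed x hxK.1 y e fun e' =>
          hxK.2 (hb.nbr x hxK.1 (e' ▸ e.symm)), fun h' => hyT ⟨h', hy⟩⟩
        exact ⟨hS x hxK y hyK e hxS, hyK⟩
      rcases hx with ⟨hxm | hxB, hxS, hxK⟩ | ⟨v, hv, hxv, hvS, hvK⟩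
      · have hy := h.nbr_middle hxm e
        exact Or.inl ⟨hy, key hxS hxK hy⟩
      · by_cases hy : y ∈ other x (K x)
        · exact Or.inr ⟨x, hxB, hy, hxS, hxK⟩
        · have hy := h.nbr_boundary hxB e hy
          exact Or.inl ⟨hy, key hxS hxK hy⟩
      · by_cases hyv : y = v
        · subst hyv
          exact Or.inl ⟨Or.inr hv, hvS, hvK⟩
        · exact Or.inr ⟨v, hv, (h.bad v hv).other_closed hxv e hyv, hvS, hvK⟩
    · rintro (h' | ⟨v, hv, h', -⟩)
      exacts [hbS h'.2.1, h.notMem_other (h.nbr_middle htm eb) hv h']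
  · obtain ⟨n, hn, e, hnT, -⟩ := h.exists_nbr_notMem hG hu htB ht
    obtain ⟨o, ho, eo⟩ := (h.bad t htB).other_nonempty
    refine ⟨other t (K t), fun x _ y hy e' hx => (h.bad t htB).other_closed hx e' ?_,
      ⟨o, fun h' => h.notMem_other h'.2 htB ho, ho, eo⟩, n, fun h' => hnT h'.1,
      h.notMem_other hn htB, e⟩
    rintro rfl
    exact hy ⟨ht, Or.inr htB⟩

theorem ncard_le (h : BadStar G B K T) (hG : ConnAccessible G) {u : W} (hu : u ∈ B) :
    (middle B K ∩ T u).ncard + (B ∩ T u).ncard + 1 ≤ B.ncard + (middle B K \ T u).ncard := by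
  have h1 := hG.unmixed _ (h.cut_inter hG hu)
  have hcard : (T u ∩ (middle B K ∪ B)).ncard = (middle B K ∩ T u).ncard + (B ∩ T u).ncard := by
    rw [← Set.ncard_union_eq]
    · congr 1; grind
    · exact Set.disjoint_left.2 fun a ha hb => h.notMem_of_middle ha.1 hb.1
  let f : W → Set W := fun x => {y | y ∉ K x ∧ (y = x → x ∉ T u)}
  have hf : ∀ x ∈ B, cComp G (f x) ≤ 1 := by
    intro x hx
    have hbx := h.bad x hx
    have h1 := (hbx.cComp_eq_one hG).2
    by_cases hxT : x ∈ T u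
    · have : f x = other x (K x) := by
        ext y; simp only [f, other, Set.mem_ofPred_eq]; tauto
      rw [this, h1]
    · have : f x = insert x (other x (K x)) := by
        ext y
        have := hbx.notMem
        simp only [f, other, Set.mem_ofPred_eq, Set.mem_insert_iff]
        grind
      obtain ⟨b, hb, e⟩ := hbx.other_nonempty
      rw [this, ← h1]
      exact cComp_insert_le hb e
  have hcover : (T u ∩ (middle B K ∪ B))ᶜ = (middle B K \ T u) ∪ ⋃ x ∈ B, f x := by
    ext y
    simp only [Set.mem_compl_iff, Set.mem_inter_iff, not_and, Set.mem_union, Set.mem_sdiff,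
      Set.mem_iUnion, exists_prop, f, Set.mem_ofPred_eq]
    constructor
    · intro hy
      rcases mem_or_other (B := B) (K := K) y with (hy' | hy') | ⟨x, hx, hyx⟩
      · exact Or.inl ⟨hy', fun h' => hy h' (Or.inl hy')⟩
      · exact Or.inr ⟨y, hy', (h.bad y hy').notMem, fun _ h' => hy h' (Or.inr hy')⟩
      · exact Or.inr ⟨x, hx, hyx.1, fun e => absurd e hyx.2⟩
    · rintro (⟨h1, h2⟩ | ⟨x, hx, h1, h2⟩) h3
      · exact absurd h3 h2
      · rintro (h4 | h4)
        · exact h1 (h4 x hx)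
        · by_cases hyx : y = x
          · exact h2 hyx (hyx ▸ h3)
          · exact h1 (h.mem x hx y h4 (Ne.symm hyx))
  have h2 := cComp_union_le G (middle B K \ T u) (⋃ x ∈ B, f x)
  have h3 := cComp_le_ncard G (middle B K \ T u)
  have h4 := cComp_biUnion_le G B f hf
  rw [hcover, hcard] at h1
  omega

theorem exists_adj_boundary (h : BadStar G B K T) (hG : ConnAccessible G) {y w : W} (hy : y ∈ B)
    (hw : w ∈ B) (hyw : y ≠ w) : ∃ z ∈ B, G.Adj y z := by
  by_contra! hn
  have hb := h.bad y hy
  have hwY : w ∉ insert y (other y (K y)) := by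
    rintro (rfl | h')
    exacts [hyw rfl, h'.1 (h.mem y hy w hw hyw)]
  have hwn : ∀ a ∈ insert y (other y (K y)), ¬ G.Adj a w := by
    rintro a (rfl | ha) e
    exacts [hn w hw e, hb.not_adj_other (h.mem y hy w hw hyw) ha e.symm]
  obtain ⟨z, hz, hzY, y', rfl | hy', e⟩ := hG.exists_cutVertex_adj ⟨y, Set.mem_insert _ _⟩ hwY hwn
  · rcases h.nbr_boundary hy e fun h' => hzY (Or.inr h') with h' | h'
    exacts [h.not_cut z h' hz, hn z h' e]
  · exact hzY (Or.inr (hb.other_closed hy' e fun e' => hzY (Or.inl e')))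

theorem not_cut_pair (h : BadStar G B K T) (hG : ConnAccessible G) {x p : W} (hx : x ∈ B)
    (hp : p ∈ middle B K)
    (hs : ∀ S : Set W, (∀ a ∈ S, ∀ b, G.Adj a b → b ≠ x → b ≠ p → b ∈ S) →
      ∀ y ∈ B, ∀ z ∈ B, y ≠ x → z ≠ x → y ∈ S → z ∈ S) : ¬ Cut G {x, p} := by
  have main : ∀ S : Set W, (∀ a ∈ S, ∀ b, G.Adj a b → b ≠ x → b ≠ p → b ∈ S) →
      (∀ y ∈ B, y ≠ x → y ∉ S) → ∀ a ∈ S, a ≠ x → a ≠ p → G.Adj p a → False := by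
    intro S hS hyS a ha hax hap e
    have hmid : ∀ b ∈ S, b ≠ x → b ∈ middle B K ∪ B → b ∈ middle B K := fun b hb hbx h' =>
      h'.resolve_right fun h'' => hyS b h'' hbx hb
    refine (h.bad x hx).false_of_nbr_region (p := p)
      (R := {r | r ∈ S ∧ r ∈ middle B K ∧ r ≠ x ∧ r ≠ p}) (fun r hr => hr.2.1 x hx)
      ⟨a, ha, hmid a ha hax (h.nbr_middle hp e), hax, hap⟩ ?_ ?_
    · rintro r ⟨hrS, hrm, hrx, hrp⟩
      obtain ⟨y, hy, ey⟩ := h.exists_adj_of_middle hG ⟨x, hx⟩ hrm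
      by_cases hyx : y = x
      · exact hyx ▸ ey.symm
      · exact absurd (hS r hrS y ey hyx fun e' => h.notMem_of_middle hp (e' ▸ hy)) (hyS y hy hyx)
    · rintro r ⟨hrS, hrm, hrx, hrp⟩ b hb eb
      by_cases hbp : b = p
      · exact Or.inr hbp
      · have hbx : b ≠ x := fun e' => (h.bad x hx).notMem (e' ▸ hb)
        have hbS := hS r hrS b eb hbx hbp
        exact Or.inl ⟨hbS, hmid b hbS hbx (h.nbr_middle hrm eb), hbx, hbp⟩
  intro hcut
  obtain ⟨S, hS, ⟨a, ha, haS, ea⟩, b, hb, hbS, eb⟩ := hcut p (by simp)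
  simp only [Set.mem_compl_iff, Set.mem_insert_iff, Set.mem_singleton_iff, not_or] at hS ha hb
  have hpB := h.notMem_of_middle hp
  have hc1 : ∀ a ∈ {y | y ∈ S ∧ y ≠ x ∧ y ≠ p}, ∀ b, G.Adj a b → b ≠ x → b ≠ p →
      b ∈ {y | y ∈ S ∧ y ≠ x ∧ y ≠ p} := fun a ha b e hbx hbp =>
    ⟨hS a ha.2 b ⟨hbx, hbp⟩ e ha.1, hbx, hbp⟩
  have hc2 : ∀ a ∈ {y | y ∉ S ∧ y ≠ x ∧ y ≠ p}, ∀ b, G.Adj a b → b ≠ x → b ≠ p →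
      b ∈ {y | y ∉ S ∧ y ≠ x ∧ y ≠ p} := fun a ha b e hbx hbp =>
    ⟨fun h' => ha.1 (hS b ⟨hbx, hbp⟩ a ha.2 e.symm h'), hbx, hbp⟩
  by_cases hy : ∃ y ∈ B, y ≠ x ∧ y ∈ S
  · obtain ⟨y, hy, hyx, hyS⟩ := hy
    refine main _ hc2 ?_ b ⟨hbS, hb⟩ hb.1 hb.2 eb
    intro z hz hzx hzS
    exact hzS.1 (hs _ hc1 y hy z hz hyx hzx ⟨hyS, hyx, fun e' => hpB (e' ▸ hy)⟩).1
  · push Not at hy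
    exact main _ hc1 (fun y hyB hyx hyS => hy y hyB hyx hyS.1) a ⟨haS, ha⟩ ha.1 ha.2 ea

theorem exists_adj_ne (h : BadStar G B K T) (hG : ConnAccessible G) {x y m : W} (hx : x ∈ B)
    (hy : y ∈ B) (hyx : y ≠ x) (hm : m ∈ middle B K)
    (hs : ∀ p ∈ middle B K, ∀ S : Set W,
      (∀ a ∈ S, ∀ b, G.Adj a b → b ≠ x → b ≠ p → b ∈ S) →
      ∀ y ∈ B, ∀ z ∈ B, y ≠ x → z ≠ x → y ∈ S → z ∈ S) : ∃ z ∈ B, z ≠ x ∧ G.Adj m z := by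
  by_contra! hn
  let Y : Set W := {a | ∃ z ∈ B, z ≠ x ∧ (a = z ∨ a ∈ other z (K z))}
  have hmY : m ∉ Y := by
    rintro ⟨z, hz, -, rfl | h'⟩
    exacts [h.notMem_of_middle hm hz, h'.1 (hm z hz)]
  have hmn : ∀ a ∈ Y, ¬ G.Adj a m := by
    rintro a ⟨z, hz, hzx, rfl | ha⟩ e
    exacts [hn a hz hzx e.symm, (h.bad z hz).not_adj_other (hm z hz) ha e.symm]
  obtain ⟨T', D, hT, hne, hmD, hDY, hTY, hadj, hcl⟩ :=
    hG.exists_boundary (Y := Y) ⟨y, y, hy, hyx, Or.inl rfl⟩ hmY hmn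
  have hTsub : ∀ t ∈ T', t ∈ middle B K ∨ t = x := by
    intro t ht
    have htY := Set.disjoint_left.1 hTY ht
    obtain ⟨a, ⟨z, hz, hzx, ha⟩, e⟩ := hadj t ht
    have hto : t ∉ other z (K z) := fun h' => htY ⟨z, hz, hzx, Or.inr h'⟩
    have htz : t ≠ z := fun h' => htY ⟨z, hz, hzx, Or.inl h'⟩
    rcases ha with rfl | ha
    · rcases h.nbr_boundary hz e hto with h' | h'
      · exact Or.inl h'
      · right
        by_contra htx
        exact htY ⟨t, h', htx, Or.inl rfl⟩
    · exact absurd ((h.bad z hz).other_closed ha e htz) hto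
  by_cases h2 : 2 ≤ T'.ncard
  · obtain ⟨z, hz, p, hp, hzp, hcz, hcp⟩ := hG.exists_pair hT h2
    obtain rfl := (hTsub z hz).resolve_left fun h' => h.not_cut z h' hcz
    have hpm := (hTsub p hp).resolve_right hzp.symm
    exact h.not_cut_pair hG hx hpm (hs p hpm) hcp
  · obtain ⟨z, hz, hcz⟩ := hG.exists_cutVertex hT hne
    obtain rfl := (hTsub z hz).resolve_left fun h' => h.not_cut z h' hcz
    have h1 : T'.ncard = 1 := by
      have := (Set.ncard_pos).2 hne
      omega
    obtain ⟨z', rfl⟩ := Set.ncard_eq_one.1 h1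
    obtain rfl : z = z' := hz
    have hb := h.bad z hx
    have := hb.eq_of_closed hG (R := D ∩ K z) Set.inter_subset_right ⟨m, hmD, hm z hx⟩ ?_
    · have hy' : y ∈ D ∩ K z := this.ge (h.mem z hx y hy hyx.symm)
      exact Set.disjoint_left.1 hDY hy'.1 ⟨y, hy, hyx, Or.inl rfl⟩
    · rintro a ⟨haD, haK⟩ b hbK e
      exact ⟨(hcl a haD b e).resolve_right fun h' => hb.notMem (h' ▸ hbK), hbK⟩

end BadStar

section CoreTheorem

open BadAt

variable {W : Type*} [Finite W] {G : SimpleGraph W}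

namespace BadStar

variable {B : Set W} {K T : W → Set W}

theorem false_of_clique (h : BadStar G B K T) (hG : ConnAccessible G) (h2 : 1 < B.ncard)
    (h3 : B.ncard ≤ 3) (hadj : ∀ x ∈ B, ∀ y ∈ B, x ≠ y → G.Adj x y) : False := by
  have htwo : ∀ m ∈ middle B K, ∀ x ∈ B, ∃ z ∈ B, z ≠ x ∧ G.Adj m z := by
    intro m hm x hx
    obtain ⟨y, hy, hyx⟩ := Set.exists_ne_of_one_lt_ncard h2 x
    refine h.exists_adj_ne hG hx hy hyx hm fun p hp S hS y hy z hz hyx hzx hyS => ?_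
    by_cases hyz : y = z
    · exact hyz ▸ hyS
    · exact hS y hyS z (hadj y hy z hz hyz) hzx fun e => h.notMem_of_middle hp (e ▸ hz)
  have hnbr : ∀ u ∈ B, ∀ m ∈ middle B K \ T u, ¬ G.Adj m u := fun u hu m hm e =>
    hm.2 ((h.bad u hu).nbr m (hm.1 u hu) e.symm)
  have hsub : ∀ u ∈ B, ∀ v ∈ B, u ≠ v → v ∈ T u := fun u hu v hv huv =>
    (h.bad u hu).nbr v (h.mem u hu v hv huv) (hadj u hu v hv huv)
  have hle : ∀ u ∈ B, (middle B K).ncard ≤ 2 * (middle B K \ T u).ncard := by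
    intro u hu
    have e1 := h.ncard_le hG hu
    have e2 := Set.ncard_inter_add_ncard_sdiff_eq_ncard (middle B K) (T u)
    have e3 : B \ {u} ⊆ B ∩ T u := fun v hv => ⟨hv.1, hsub u hu v hv.1 (Ne.symm hv.2)⟩
    have e4 := Set.ncard_le_ncard e3
    rw [Set.ncard_sdiff_singleton_of_mem hu] at e4
    omega
  obtain ⟨u, hu, v, hv, huv⟩ := (Set.one_lt_ncard).1 h2
  have hM : (middle B K).ncard = 0 := by
    by_cases hw : ∃ w ∈ B, w ≠ u ∧ w ≠ v
    · obtain ⟨w, hw, hwu, hwv⟩ := hw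
      have hB : B = {u, v, w} := by
        refine (Set.eq_of_subset_of_ncard_le ?_ ?_).symm
        · rintro x (rfl | rfl | rfl) <;> assumption
        · rwa [Set.ncard_eq_three.2 ⟨u, v, w, huv, hwu.symm, hwv.symm, rfl⟩]
      have hd : ∀ x ∈ B, ∀ y ∈ B, x ≠ y →
          Disjoint (middle B K \ T x) (middle B K \ T y) := by
        intro x hx y hy hxy
        refine Set.disjoint_left.2 fun m hmx hmy => ?_
        obtain ⟨z, hz, hzx, ez⟩ := htwo m hmx.1 x hx
        obtain ⟨z', hz', hzz, ez'⟩ := htwo m hmx.1 z hz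
        have h1 : z ≠ y := fun e => hnbr y hy m hmy (e ▸ ez)
        have h2 : z' ≠ y := fun e => hnbr y hy m hmy (e ▸ ez')
        have h3 : z' ≠ x := fun e => hnbr x hx m hmx (e ▸ ez')
        rw [hB] at hx hy hz hz'
        simp only [Set.mem_insert_iff, Set.mem_singleton_iff] at hx hy hz hz'
        grind
      have e1 := hle u hu
      have e2 := hle v hv
      have e3 := hle w hw
      have e4 : ((middle B K \ T u ∪ middle B K \ T v) ∪ middle B K \ T w).ncard ≤
          (middle B K).ncard := Set.ncard_le_ncard (by grind)
      rw [Set.ncard_union_eq (Set.disjoint_union_left.2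
        ⟨hd u hu w hw hwu.symm, hd v hv w hw hwv.symm⟩), Set.ncard_union_eq (hd u hu v hv huv)] at e4
      omega
    · push Not at hw
      have e1 : middle B K \ T u = ∅ := by
        by_contra hne
        obtain ⟨m, hm⟩ := Set.nonempty_iff_ne_empty.2 hne
        obtain ⟨z, hz, hzv, e⟩ := htwo m hm.1 v hv
        by_cases hzu : z = u
        · exact hnbr u hu m hm (hzu ▸ e)
        · exact hzv (hw z hz hzu)
      have e2 := hle u hu
      rw [e1, Set.ncard_empty] at e2
      omega
  rw [Set.ncard_eq_zero] at hM
  obtain ⟨n, hn, e, hnT, hnu⟩ := h.exists_nbr_notMem hG hu hv (hsub u hu v hv huv)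
  rw [hM, Set.empty_union] at hn
  exact hnT (hsub u hu n hn hnu.symm)

theorem inter_eq_of_path {u v w : W} (h : BadStar G {u, v, w} K T) (hG : ConnAccessible G)
    (huv : G.Adj u v) (hvw : G.Adj v w) (huw : u ≠ w) :
    middle {u, v, w} K ∩ T u = middle {u, v, w} K \ T v ∧
      (middle {u, v, w} K ∩ T v).ncard ≤ (middle {u, v, w} K \ T v).ncard ∧
      ∀ m ∈ middle {u, v, w} K \ T v, G.Adj m u := by
  have hu : u ∈ ({u, v, w} : Set W) := by simp
  have hv : v ∈ ({u, v, w} : Set W) := by simp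
  have hw : w ∈ ({u, v, w} : Set W) := by simp
  have hB : ({u, v, w} : Set W).ncard = 3 :=
    Set.ncard_eq_three.2 ⟨u, v, w, huv.ne, huw, hvw.ne, rfl⟩
  generalize hBe : ({u, v, w} : Set W) = B at *
  have hadj : ∀ m ∈ middle B K, G.Adj m v ∨ G.Adj m u := by
    intro m hm
    have hex : ∃ z ∈ B, z ≠ w ∧ G.Adj m z := by
      refine h.exists_adj_ne hG hw hv hvw.ne hm ?_
      intro p hp S hS y hy z hz hyw hzw hyS
      have hpu : u ≠ p := fun e => h.notMem_of_middle hp (e ▸ hu)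
      have hpv : v ≠ p := fun e => h.notMem_of_middle hp (e ▸ hv)
      have h1 := fun hu' => hS u hu' v huv hvw.ne hpv
      have h2 := fun hv' => hS v hv' u huv.symm huw hpu
      rw [← hBe] at hy hz
      simp only [Set.mem_insert_iff, Set.mem_singleton_iff] at hy hz
      grind
    obtain ⟨z, hz, hzw, e⟩ := hex
    rw [← hBe] at hz
    rcases hz with rfl | rfl | rfl
    exacts [Or.inr e, Or.inl e, absurd rfl hzw]
  have hadj' : ∀ m ∈ middle B K \ T v, G.Adj m u := fun m hm =>
    (hadj m hm.1).resolve_left fun e => hm.2 ((h.bad v hv).nbr m (hm.1 v hv) e.symm)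
  have hsub : middle B K \ T v ⊆ middle B K ∩ T u := fun m hm =>
    ⟨hm.1, (h.bad u hu).nbr m (hm.1 u hu) (hadj' m hm).symm⟩
  have hvT : {u, w} ⊆ B ∩ T v := by
    rintro x (rfl | rfl)
    · exact ⟨hu, (h.bad v hv).nbr x (h.mem v hv x hu huv.ne') huv.symm⟩
    · exact ⟨hw, (h.bad v hv).nbr x (h.mem v hv x hw hvw.ne) hvw⟩
  have huT : {v} ⊆ B ∩ T u := by
    rintro x rfl
    exact ⟨hv, (h.bad u hu).nbr x (h.mem u hu x hv huv.ne) huv⟩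
  have e1 := Set.ncard_le_ncard hvT
  have e2 := Set.ncard_le_ncard huT
  rw [Set.ncard_pair huw] at e1
  rw [Set.ncard_singleton] at e2
  have e3 := h.ncard_le hG hu
  have e4 := h.ncard_le hG hv
  have e5 := Set.ncard_inter_add_ncard_sdiff_eq_ncard (middle B K) (T u)
  have e6 := Set.ncard_inter_add_ncard_sdiff_eq_ncard (middle B K) (T v)
  have e7 := Set.ncard_le_ncard hsub
  exact ⟨(Set.eq_of_subset_of_ncard_le hsub (by omega)).symm, by omega, hadj'⟩

theorem false_of_path {u v w : W} (h : BadStar G {u, v, w} K T) (hG : ConnAccessible G)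
    (huv : G.Adj u v) (hvw : G.Adj v w) (huw : u ≠ w) (hnuw : ¬ G.Adj u w) : False := by
  obtain ⟨hPu, hle, hQu⟩ := h.inter_eq_of_path hG huv hvw huw
  have hrev : ({u, v, w} : Set W) = {w, v, u} := by grind
  obtain ⟨hPw, hQw⟩ : middle {u, v, w} K ∩ T w = middle {u, v, w} K \ T v ∧
      ∀ m ∈ middle {u, v, w} K \ T v, G.Adj m w := by
    have h' := h
    rw [hrev] at h' ⊢
    have h'' := h'.inter_eq_of_path hG hvw.symm huv.symm huw.symm
    exact ⟨h''.1, h''.2.2⟩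
  have hu : u ∈ ({u, v, w} : Set W) := by simp
  have hv : v ∈ ({u, v, w} : Set W) := by simp
  have hw : w ∈ ({u, v, w} : Set W) := by simp
  have hmem : ∀ x ∈ ({u, v, w} : Set W), x = u ∨ x = v ∨ x = w := fun x hx => by simpa using hx
  generalize ({u, v, w} : Set W) = B at *
  have hmu : ∀ m ∈ middle B K, m ∈ T u ↔ m ∉ T v := fun m hm => by
    have := Set.ext_iff.1 hPu m
    simpa [hm] using this
  have hmw : ∀ m ∈ middle B K, m ∈ T w ↔ m ∉ T v := fun m hm => by
    have := Set.ext_iff.1 hPw m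
    simpa [hm] using this
  have hvu : v ∈ T u := (h.bad u hu).nbr v (h.mem u hu v hv huv.ne) huv
  have huv' : u ∈ T v := (h.bad v hv).nbr u (h.mem v hv u hu huv.ne') huv.symm
  have hwv' : w ∈ T v := (h.bad v hv).nbr w (h.mem v hv w hw hvw.ne) hvw
  have huu : u ∉ T u := fun h' => (h.bad u hu).notMem ((h.bad u hu).subset h')
  have hvv : v ∉ T v := fun h' => (h.bad v hv).notMem ((h.bad v hv).subset h')
  have hwu : w ∉ T u := by
    intro hwT
    obtain ⟨n, hn, e, hnT, hnu⟩ := h.exists_nbr_notMem hG hu hw hwT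
    rcases hn with hn | hn
    · exact hnT ((hmu n hn).2 ((hmw n hn).1 ((h.bad w hw).nbr n (hn w hw) e)))
    · rcases hmem n hn with rfl | rfl | rfl
      exacts [hnu rfl, hnT hvu, e.ne rfl]
  have hQ : ∃ q ∈ middle B K, q ∉ T v := by
    by_contra! hall
    have h1 : middle B K \ T v = ∅ := Set.sdiff_eq_empty.2 hall
    rw [h1, Set.ncard_empty, Nat.le_zero, Set.ncard_eq_zero] at hle
    obtain ⟨n, hn, e, hnT, hnv⟩ := h.exists_nbr_notMem hG hv hu huv'
    rcases hn with hn | hn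
    · exact hnT (hall n hn)
    · rcases hmem n hn with rfl | rfl | rfl
      exacts [hnT huv', hnv rfl, hnT hwv']
  obtain ⟨q₀, hq₀, hq₀v⟩ := hQ
  obtain ⟨x, ⟨hxu, hxB⟩, q, ⟨hqu, hqB⟩, hxq, hx, hxqc⟩ :=
    hG.exists_pair (h.cut_inter hG hu) ((Set.one_lt_ncard).2 ⟨v, ⟨hvu, Or.inr hv⟩, q₀,
      ⟨(hmu q₀ hq₀).2 hq₀v, Or.inl hq₀⟩, fun e => h.notMem_of_middle hq₀ (e ▸ hv)⟩)
  obtain rfl : x = v := by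
    rcases hmem x (hxB.resolve_left fun h' => h.not_cut x h' hx) with rfl | rfl | rfl
    exacts [absurd hxu huu, rfl, absurd hxu hwu]
  have hqm : q ∈ middle B K := by
    refine hqB.resolve_right fun h' => ?_
    rcases hmem q h' with rfl | rfl | rfl
    exacts [huu hqu, hxq rfl, hwu hqu]
  have huniq : ∀ m ∈ middle B K, m ∉ T x → m = q := by
    intro m hm hmx
    by_contra hmq
    refine h.not_cut_pair hG hv hqm (fun S hS y hy z hz hyx hzx hyS => ?_) hxqc
    have hmx' : m ≠ x := fun e => h.notMem_of_middle hm (e ▸ hv)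
    have hB : ∀ y ∈ B, y ≠ x → G.Adj m y := by
      intro y hy hyx
      rcases hmem y hy with rfl | rfl | rfl
      exacts [hQu m ⟨hm, hmx⟩, absurd rfl hyx, hQw m ⟨hm, hmx⟩]
    exact hS m (hS y hyS m (hB y hy hyx).symm hmx' hmq) z (hB z hz hzx) hzx
      fun e => h.notMem_of_middle hqm (e ▸ hz)
  by_cases hP : ∃ p ∈ middle B K, p ∈ T x
  · obtain ⟨p, hp, hpT⟩ := hP
    have key : ∀ n ∈ K x \ T x, G.Adj p n → n = q := by
      intro n hn e
      rcases h.nbr_middle hp e with hnm | hnB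
      · exact huniq n hnm hn.2
      · rcases hmem n hnB with rfl | rfl | rfl
        exacts [absurd huv' hn.2, absurd hn.1 (h.bad n hv).notMem, absurd hwv' hn.2]
    obtain ⟨S, -, ⟨a, ha, haS, ea⟩, b, hb, hbS, eb⟩ := (h.bad x hv).reconn p hpT
    exact hbS (key b hb eb ▸ key a ha ea ▸ haS)
  · push Not at hP
    have key : ∀ n ∈ K u \ T u, G.Adj q n → n = w := by
      intro n hn e
      rcases h.nbr_middle hqm e with hnm | hnB
      · exact absurd ((hmu n hnm).2 (hP n hnm)) hn.2
      · rcases hmem n hnB with rfl | rfl | rfl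
        exacts [absurd hn.1 (h.bad n hu).notMem, absurd hvu hn.2, rfl]
    obtain ⟨S, -, ⟨a, ha, haS, ea⟩, b, hb, hbS, eb⟩ := (h.bad u hu).reconn q hqu
    exact hbS (key b hb eb ▸ key a ha ea ▸ haS)

theorem false_of_ncard (h : BadStar G B K T) (hG : ConnAccessible G) (h2 : 1 < B.ncard)
    (h3 : B.ncard ≤ 3) : False := by
  by_cases hadj : ∀ x ∈ B, ∀ y ∈ B, x ≠ y → G.Adj x y
  · exact h.false_of_clique hG h2 h3 hadj
  push Not at hadj
  obtain ⟨u, hu, w, hw, huw, hn⟩ := hadj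
  obtain ⟨v, hv, e1⟩ := h.exists_adj_boundary hG hu hw huw
  obtain ⟨v', hv', e2⟩ := h.exists_adj_boundary hG hw hu huw.symm
  have hvw : v ≠ w := fun e => hn (e ▸ e1)
  have hB : B = {u, v, w} := by
    refine (Set.eq_of_subset_of_ncard_le ?_ ?_).symm
    · rintro x (rfl | rfl | rfl) <;> assumption
    · rwa [Set.ncard_eq_three.2 ⟨u, v, w, e1.ne, huw, hvw, rfl⟩]
  subst hB
  rcases hv' with rfl | rfl | rfl
  exacts [hn e2.symm, h.false_of_path hG e1 e2.symm huw hn, e2.ne rfl]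

end BadStar

theorem exists_badAt {x : W} {T : Set W} (hx : Cut G {x}) (hxT : x ∉ T)
    (hT : ∀ t ∈ T, Reconn G (insert x T)ᶜ t) (hxT' : ¬ Reconn G (insert x T)ᶜ x) :
    ∃ K T', BadAt G x K T' := by
  obtain ⟨S, hS, ⟨a, ha, haS, ea⟩, b, hb, hbS, eb⟩ := hx x rfl
  simp only [Set.mem_compl_iff, Set.mem_singleton_iff] at hS ha hb
  have key : ∀ K : Set W, x ∉ K → (∀ a ∈ K, ∀ b, G.Adj a b → b ≠ x → b ∈ K) →
      (∃ a ∈ K, G.Adj x a) → (∃ b, b ∉ K ∧ G.Adj x b) → (∀ a ∈ K, G.Adj x a → a ∈ T) →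
      BadAt G x K (T ∩ K) := by
    intro K hxK hcl h1 h2 h3
    refine ⟨hxK, hcl, h1, h2, Set.inter_subset_right, fun a ha e => ⟨h3 a ha e, ha⟩, ?_⟩
    rintro t ⟨htT, htK⟩
    refine (hT t htT).restrict ?_ ?_
    · rintro y ⟨hyK, hyT⟩ (rfl | h')
      exacts [hxK hyK, hyT ⟨h', hyK⟩]
    · intro y hy e
      exact ⟨hcl t htK y e fun e' => hy (Or.inl e'), fun h' => hy (Or.inr h'.1)⟩
  by_contra! hn
  have h1 : ∃ a, a ∈ S ∧ a ≠ x ∧ G.Adj x a ∧ a ∉ T := by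
    by_contra! h1
    refine hn {y | y ∈ S ∧ y ≠ x} _ (key {y | y ∈ S ∧ y ≠ x} (fun h' => h'.2 rfl) ?_
      ⟨a, ⟨haS, ha⟩, ea⟩ ⟨b, fun h' => hbS h'.1, eb⟩ fun a ha e => h1 a ha.1 ha.2 e)
    exact fun a ha b e hb => ⟨hS a ha.2 b hb e ha.1, hb⟩
  have h2 : ∃ a, a ∉ S ∧ a ≠ x ∧ G.Adj x a ∧ a ∉ T := by
    by_contra! h2
    refine hn {y | y ∉ S ∧ y ≠ x} _ (key {y | y ∉ S ∧ y ≠ x} (fun h' => h'.2 rfl) ?_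
      ⟨b, ⟨hbS, hb⟩, eb⟩ ⟨a, fun h' => h'.1 haS, ea⟩ fun a ha e => h2 a ha.1 ha.2 e)
    exact fun a ha b e hb => ⟨fun h' => ha.1 (hS b hb a ha.2 e.symm h'), hb⟩
  obtain ⟨c, hcS, hcx, ec, hcT⟩ := h1
  obtain ⟨d, hdS, hdx, ed, hdT⟩ := h2
  refine hxT' ⟨S, fun y hy z hz e => hS y (fun e => hy (Or.inl e)) z (fun e => hz (Or.inl e)) e,
    ⟨c, ?_, hcS, ec⟩, d, ?_, hdS, ed⟩
  · rintro (h' | h')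
    exacts [hcx h', hcT h']
  · rintro (h' | h')
    exacts [hdx h', hdT h']

/-- A connected accessible graph which is not complete and has at most three cut vertices has a
cut vertex `x` that can be added to every cutset of `G ∖ {x}`. -/
theorem ConnAccessible.exists_good (hG : ConnAccessible G) {a b : W} (hab : a ≠ b)
    (hnab : ¬ G.Adj a b) (hC : {x | Cut G {x}}.ncard ≤ 3) :
    ∃ x, Cut G {x} ∧ ∀ T : Set W, x ∉ T → (∀ t ∈ T, Reconn G (insert x T)ᶜ t) →
      Reconn G (insert x T)ᶜ x := by
  by_contra! hn
  have hbad : ∀ x, ∃ K T, Cut G {x} → BadAt G x K T := by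
    intro x
    by_cases hx : Cut G {x}
    · obtain ⟨T, h1, h2, h3⟩ := hn x hx
      obtain ⟨K, T', h⟩ := exists_badAt hx h1 h2 h3
      exact ⟨K, T', fun _ => h⟩
    · exact ⟨∅, ∅, fun h => absurd h hx⟩
  choose K T hbad using hbad
  obtain ⟨x₀, hx₀, -⟩ := hG.exists_cutVertex_adj (Y := {a}) ⟨a, rfl⟩ (w := b) (by simpa using hab.symm)
    (by simpa)
  by_cases hall : ∀ x, Cut G {x} → ∀ y, Cut G {y} → x ≠ y → y ∈ K x
  · refine BadStar.false_of_ncard (B := {x | Cut G {x}}) (K := K) (T := T)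
      ⟨fun x hx => hbad x hx, fun x hx y hy => hall x hx y hy,
        fun m hm hmc => (hbad m hmc).notMem (hm m hmc)⟩ hG ?_ hC
    obtain ⟨y, hyK, hy⟩ := (hbad x₀ hx₀).exists_cutVertex hG
    exact (Set.one_lt_ncard).2 ⟨x₀, hx₀, y, hy, fun e => (hbad x₀ hx₀).notMem (e ▸ hyK)⟩
  · push Not at hall
    obtain ⟨x, hx, y, hy, hxy, hyK⟩ := hall
    obtain ⟨z, hzK, hz⟩ := (hbad x hx).exists_cutVertex hG
    have hzx : x ≠ z := fun e => (hbad x hx).notMem (e ▸ hzK)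
    have hzy : y ≠ z := fun e => hyK (e ▸ hzK)
    have hCe : {x | Cut G {x}} = {x, y, z} := by
      refine (Set.eq_of_subset_of_ncard_le ?_ ?_).symm
      · rintro t (rfl | rfl | rfl) <;> assumption
      · rwa [Set.ncard_eq_three.2 ⟨x, y, z, hxy, hzx, hzy, rfl⟩]
    have hmem : ∀ t, Cut G {t} → t = x ∨ t = y ∨ t = z := fun t ht => by
      have : t ∈ {x | Cut G {x}} := ht
      rw [hCe] at this
      simpa using this
    have hxz : x ∈ K z := by
      by_contra hxz
      obtain ⟨t, htK, ht⟩ := (hbad z hz).exists_cutVertex hG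
      have hyz : y ∈ K z := by
        rcases hmem t ht with rfl | rfl | rfl
        exacts [absurd htK hxz, htK, absurd htK (hbad t ht).notMem]
      refine (hG.conn (K z ∩ other x (K x)) ⟨y, hyz, hyK, hxy.symm⟩ ?_ x).2.2 rfl
      rintro c ⟨hcz, hcx⟩ d e
      refine ⟨(hbad z hz).closed c hcz d e ?_, (hbad x hx).other_closed hcx e ?_⟩
      · rintro rfl
        exact (hbad x hx).not_adj_other hzK hcx e.symm
      · rintro rfl
        exact (hbad z hz).not_adj_other hcz ⟨hxz, hzx⟩ e
    refine BadStar.false_of_ncard (B := {x, z}) (K := K) (T := T) ⟨?_, ?_, ?_⟩ hG ?_ ?_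
    · rintro t (rfl | rfl)
      exacts [hbad t hx, hbad t hz]
    · rintro s (rfl | rfl) t (rfl | rfl) hst
      exacts [absurd rfl hst, hzK, hxz, absurd rfl hst]
    · intro m hm hmc
      rcases hmem m hmc with rfl | rfl | rfl
      exacts [(hbad m hmc).notMem (hm m (by simp)), hyK (hm x (by simp)),
        (hbad m hmc).notMem (hm m (by simp))]
    · rw [Set.ncard_pair hzx]; omega
    · rw [Set.ncard_pair hzx]; omega

end CoreTheorem

section Deletion

variable {V : Type*} [Finite V] {G : SimpleGraph V} {A : Set V} {v : V}

/-- Cutsets of `G[A]`, phrased for arbitrary sets of vertices. -/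
def CutIn (G : SimpleGraph V) (A T : Set V) : Prop := T ⊆ A ∧ ∀ t ∈ T, Reconn G (A \ T) t

/-- Accessibility of `G[A]`, phrased for arbitrary sets of vertices. -/
structure AccIn (G : SimpleGraph V) (A : Set V) : Prop where
  unmixed : ∀ T, CutIn G A T → cComp G (A \ T) = T.ncard + cComp G A
  acc : ∀ T, CutIn G A T → T.Nonempty → ∃ t ∈ T, CutIn G A (T \ {t})

/-- The vertex `v` can be added to every cutset of `G[A] ∖ {v}`. -/
def GoodAt (G : SimpleGraph V) (A : Set V) (v : V) : Prop :=
  v ∈ A ∧ ∀ T, CutIn G (A \ {v}) T → Reconn G ((A \ {v}) \ T) v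

theorem cutIn_empty (G : SimpleGraph V) (A : Set V) : CutIn G A ∅ :=
  ⟨Set.empty_subset A, fun _ h => h.elim⟩

theorem sdiff_insert_eq (A T : Set V) (v : V) : A \ insert v T = (A \ {v}) \ T := by grind

theorem cutIn_singleton : CutIn G A {v} ↔ CutVertexOn G A v := by
  rw [cutVertexOn_iff, CutIn]
  simp

theorem cComp_union_lt {X Y : Set V} {a b : V} (ha : a ∈ X) (hb : b ∈ Y)
    (e : G.Adj a b) : cComp G (X ∪ Y) < cComp G X + cComp G Y := by
  let R : Set V := {r | ReachIn G X a r}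
  have hR : R ⊆ X := fun r hr => hr.2.1
  have h1 : cComp G X = cComp G R + cComp G (X \ R) := by
    conv_lhs => rw [← Set.union_sdiff_cancel hR]
    exact cComp_union Set.disjoint_sdiff_right fun x hx y hy e' =>
      hy.2 (hx.trans (.of_adj (hR hx) hy.1 e'))
  have h2 : cComp G (R ∪ Y) ≤ cComp G Y := by
    refine cComp_le_of_surjective id (fun y hy => Or.inr hy) (fun _ _ _ _ e => e) ?_
    rintro y (hy | hy)
    · refine ⟨b, hb, ReachIn.symm ?_⟩
      refine ReachIn.trans (b := a) ?_ (.of_adj (Or.inl (.refl ha)) (Or.inr hb) e)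
      refine (ReachIn.mem_of_closed hy (S := {z | z ∈ R ∧ ReachIn G (R ∪ Y) a z}) ?_
        ⟨.refl ha, .refl (Or.inl (.refl ha))⟩).2.symm
      rintro z hz w hw e' ⟨hzR, hz'⟩
      have hwR : w ∈ R := hzR.trans (.of_adj hz hw e')
      exact ⟨hwR, hz'.trans (.of_adj (Or.inl hzR) (Or.inl hwR) e')⟩
    · exact ⟨y, hy, .refl (Or.inr hy)⟩
  have h3 : X ∪ Y = (X \ R) ∪ (R ∪ Y) := by grind
  have h4 := one_le_cComp G (X := R) ⟨a, .refl ha⟩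
  have h5 := cComp_union_le G (X \ R) (R ∪ Y)
  rw [h3]
  omega

theorem cComp_sdiff_le (hU : ∀ T, CutIn G A T → cComp G (A \ T) = T.ncard + cComp G A) {Z : Set V}
    (hZ : Z ⊆ A) : cComp G (A \ Z) ≤ Z.ncard + cComp G A ∧
      (¬ CutIn G A Z → cComp G (A \ Z) < Z.ncard + cComp G A) := by
  induction h : Z.ncard generalizing Z with
  | zero =>
    rw [Set.ncard_eq_zero] at h
    subst h
    exact ⟨by simp, fun h' => absurd (cutIn_empty G A) h'⟩
  | succ n ih =>
    by_cases hc : CutIn G A Z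
    · exact ⟨by rw [hU Z hc, h], fun h' => absurd hc h'⟩
    · have hz : ∃ z ∈ Z, ¬ Reconn G (A \ Z) z := by
        by_contra! hall
        exact hc ⟨hZ, hall⟩
      obtain ⟨z, hz, hzr⟩ := hz
      have h1 := cComp_le_insert hzr
      have h2 : insert z (A \ Z) = A \ (Z \ {z}) := by
        have := hZ hz
        grind
      have h3 := Set.ncard_sdiff_singleton_of_mem hz
      rw [h2] at h1
      have h4 := (ih (Z := Z \ {z}) (Set.sdiff_subset.trans hZ) (by omega)).1
      exact ⟨by omega, fun _ => by omega⟩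

namespace GoodAt

theorem reconn (h : GoodAt G A v) : Reconn G (A \ {v}) v := by
  simpa using h.2 ∅ (cutIn_empty _ _)

theorem cutVertexOn (h : GoodAt G A v) : CutVertexOn G A v := cutVertexOn_iff.2 ⟨h.1, h.reconn⟩

theorem cutIn_insert (h : GoodAt G A v) {T : Set V} (hT : CutIn G (A \ {v}) T) :
    CutIn G A (insert v T) := by
  refine ⟨Set.insert_subset h.1 (hT.1.trans Set.sdiff_subset), ?_⟩
  rw [sdiff_insert_eq]
  rintro t (rfl | ht)
  exacts [h.2 T hT, hT.2 t ht]

theorem cComp_sdiff (h : GoodAt G A v) (hA : AccIn G A) :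
    cComp G (A \ {v}) = cComp G A + 1 := by
  rw [hA.unmixed {v} (cutIn_singleton.2 h.cutVertexOn), Set.ncard_singleton, add_comm]

theorem exists_nbr (h : GoodAt G A v) (hA : AccIn G A) {T S : Set V} (hT : CutIn G (A \ {v}) T)
    (hS : ∀ x ∈ A \ {v}, ∀ y ∈ A \ {v}, G.Adj x y → x ∈ S → y ∈ S)
    (ha : ∃ a ∈ A \ {v}, a ∈ S ∧ G.Adj v a) : ∃ a ∈ A \ {v}, a ∈ S ∧ a ∉ T ∧ G.Adj v a := by
  by_contra! hn
  have hTS : CutIn G (A \ {v}) (T ∩ S) := by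
    refine ⟨Set.inter_subset_left.trans hT.1, ?_⟩
    rintro t ⟨htT, htS⟩
    refine (((hT.2 t htT).restrict (X := S ∩ ((A \ {v}) \ T)) (by grind) ?_)).lift (by grind) ?_
    · exact fun y hy e => ⟨hS t (hT.1 htT) y hy.1 e htS, hy⟩
    · rintro x ⟨hxS, hx⟩ y hy e
      have hyS := hS x hx.1 y hy.1 e hxS
      exact ⟨hyS, hy.1, fun hyT => hy.2 ⟨hyT, hyS⟩⟩
  have h1 : Reconn G ((A \ {v}) \ S) v := by
    refine (h.2 _ hTS).restrict (by grind) fun y hy e => ⟨hy.1, fun hyS => ?_⟩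
    exact hn y hy.1 hyS (fun hyT => hy.2 ⟨hyT, hyS⟩) e
  have h2 := cComp_insert_lt h1
  obtain ⟨a, haA, haS, e⟩ := ha
  have h3 := cComp_union_lt (X := (A \ {v}) ∩ S) (Y := insert v ((A \ {v}) \ S))
    ⟨haA, haS⟩ (Set.mem_insert _ _) e.symm
  have h4 : (A \ {v}) ∩ S ∪ insert v ((A \ {v}) \ S) = A := by
    have := h.1
    grind
  have h5 : cComp G (A \ {v}) = cComp G ((A \ {v}) ∩ S) + cComp G ((A \ {v}) \ S) := by
    conv_lhs => rw [← Set.inter_union_sdiff (A \ {v}) S]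
    exact cComp_union (Set.disjoint_left.2 (by grind)) fun x hx y hy e' =>
      hy.2 (hS x hx.1 y hy.1 e' hx.2)
  have h6 := h.cComp_sdiff hA
  rw [h4] at h3
  omega

theorem accIn_sdiff (h : GoodAt G A v) (hA : AccIn G A) : AccIn G (A \ {v}) := by
  have hv : ∀ T, CutIn G (A \ {v}) T → v ∉ T := fun T hT hvT => (hT.1 hvT).2 rfl
  have hU : ∀ T, CutIn G (A \ {v}) T →
      cComp G ((A \ {v}) \ T) = T.ncard + cComp G (A \ {v}) := by
    intro T hT
    have := hA.unmixed _ (h.cutIn_insert hT)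
    rw [sdiff_insert_eq, Set.ncard_insert_of_notMem (hv T hT)] at this
    rw [this, h.cComp_sdiff hA]
    omega
  refine ⟨hU, fun T hT hne => ?_⟩
  obtain ⟨r, hr, hTr⟩ := hA.acc _ (h.cutIn_insert hT) (Set.insert_nonempty _ _)
  have hvT := hv T hT
  rcases hr with rfl | hr
  · have h1 : insert r T \ {r} = T := by grind
    rw [h1] at hTr
    obtain ⟨t, ht, hTt⟩ := hA.acc T hTr hne
    refine ⟨t, ht, ?_⟩
    by_contra hn
    have h2 := (cComp_sdiff_le hU (Set.sdiff_subset.trans hT.1)).2 hn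
    obtain ⟨S, hS, ha, b, hb, hbS, hrb⟩ := h.reconn
    obtain ⟨a', ha', haS', haT', ea⟩ := h.exists_nbr hA hT hS ha
    obtain ⟨b', hb', hbS', hbT', eb⟩ := h.exists_nbr hA (S := Sᶜ) hT
      (fun x hx y hy e hxS hyS => hxS (hS y hy x hx e.symm hyS)) ⟨b, hb, hbS, hrb⟩
    have h3 : Reconn G ((A \ {r}) \ (T \ {t})) r :=
      ⟨S, fun x hx y hy => hS x hx.1 y hy.1, ⟨a', ⟨ha', fun h' => haT' h'.1⟩, haS', ea⟩,
        b', ⟨hb', fun h' => hbT' h'.1⟩, hbS', eb⟩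
    have h4 := cComp_insert_lt h3
    have h5 : insert r ((A \ {r}) \ (T \ {t})) = A \ (T \ {t}) := by
      have := h.1
      grind
    have h6 := h.cComp_sdiff hA
    rw [h5, hA.unmixed _ hTt] at h4
    omega
  · refine ⟨r, hr, Set.sdiff_subset.trans hT.1, fun t ht => ?_⟩
    have h1 := hTr.2 t ⟨Or.inr ht.1, ht.2⟩
    have h2 : A \ (insert v T \ {r}) = (A \ {v}) \ (T \ {r}) := by grind
    rwa [h2] at h1

end GoodAt

end Deletion

section CliqueClosure

variable {V : Type*}

/-- The graph `H` restricted to `A` is obtained from `G[A]` by completing the neighbourhood of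
the vertex `v`. -/
def IsClique (G H : SimpleGraph V) (A : Set V) (v : V) : Prop :=
  v ∈ A ∧ ∀ a ∈ A, ∀ b ∈ A, H.Adj a b ↔ G.Adj a b ∨ a ≠ b ∧ G.Adj v a ∧ G.Adj v b

theorem isClique_cliqueAtOn (G : SimpleGraph V) {A : Set V} {v : V} (hv : v ∈ A) :
    IsClique G (cliqueAtOn G A v) A v := by
  refine ⟨hv, fun a ha b hb => ?_⟩
  simp only [cliqueAtOn, SimpleGraph.sup_adj, SimpleGraph.fromRel_adj]
  tauto

namespace IsClique

variable {G H : SimpleGraph V} {A X T : Set V} {v t a b : V}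

theorem mono (h : IsClique G H A v) (hX : X ⊆ A) (hv : v ∈ X) : IsClique G H X v :=
  ⟨hv, fun a ha b hb => h.2 a (hX ha) b (hX hb)⟩

theorem adj_iff (h : IsClique G H A v) (ha : a ∈ A) : H.Adj v a ↔ G.Adj v a := by
  rw [h.2 v h.1 a ha]
  simp

theorem adj_of_adj (h : IsClique G H A v) (ha : a ∈ A) (hb : b ∈ A) (e : G.Adj a b) : H.Adj a b :=
  (h.2 a ha b hb).2 (Or.inl e)

theorem reachIn_iff (h : IsClique G H X v) : ReachIn H X a b ↔ ReachIn G X a b := by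
  constructor
  · intro hab
    refine hab.mem_of_closed (S := {c | ReachIn G X a c}) ?_ (.refl hab.1)
    intro x hx y hy e hax
    rcases (h.2 x hx y hy).1 e with e | ⟨-, e1, e2⟩
    · exact hax.trans (.of_adj hx hy e)
    · exact (hax.trans (.of_adj hx h.1 e1.symm)).trans (.of_adj h.1 hy e2)
  · intro hab
    exact hab.map id (fun _ hx => hx) fun x hx y hy => h.adj_of_adj hx hy

theorem not_reconn (h : IsClique G H A v) (hX : X ⊆ A) : ¬ Reconn H X v := by
  rw [reconn_iff]
  rintro ⟨a, ha, b, hb, e1, e2, hn⟩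
  rw [h.adj_iff (hX ha)] at e1
  rw [h.adj_iff (hX hb)] at e2
  by_cases hab : a = b
  · subst hab
    exact hn (.refl ha)
  · exact hn (.of_adj ha hb ((h.2 a (hX ha) b (hX hb)).2 (Or.inr ⟨hab, e1, e2⟩)))

theorem reconn_iff (h : IsClique G H A v) (hX : X ⊆ A) (hvX : v ∈ X) (ht : t ∈ A) :
    Reconn H X t ↔ Reconn G X t := by
  have hX' := h.mono hX hvX
  rw [_root_.reconn_iff, _root_.reconn_iff]
  constructor
  · have key : ∀ a ∈ X, H.Adj t a → ∃ a' ∈ X, G.Adj t a' ∧ ReachIn G X a' a := by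
      intro a ha e
      rcases (h.2 t ht a (hX ha)).1 e with e | ⟨-, e1, e2⟩
      · exact ⟨a, ha, e, .refl ha⟩
      · exact ⟨v, hvX, e1.symm, .of_adj hvX ha e2⟩
    rintro ⟨a, ha, b, hb, e1, e2, hn⟩
    obtain ⟨a', ha', ea, ra⟩ := key a ha e1
    obtain ⟨b', hb', eb, rb⟩ := key b hb e2
    rw [hX'.reachIn_iff] at hn
    exact ⟨a', ha', b', hb', ea, eb, fun hr => hn ((ra.symm.trans hr).trans rb)⟩
  · rintro ⟨a, ha, b, hb, e1, e2, hn⟩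
    exact ⟨a, ha, b, hb, h.adj_of_adj ht (hX ha) e1, h.adj_of_adj ht (hX hb) e2,
      by rwa [hX'.reachIn_iff]⟩

theorem reconn_insert (h : IsClique G H A v) (hX : insert v X ⊆ A) (ht : t ∈ A)
    (hr : Reconn H X t) : Reconn G (insert v X) t := by
  rw [← h.reconn_iff hX (Set.mem_insert _ _) ht]
  obtain ⟨a, ha, b, hb, e1, e2, hn⟩ := _root_.reconn_iff.1 hr
  exact _root_.reconn_iff.2 ⟨a, Or.inr ha, b, Or.inr hb, e1, e2, fun hab =>
    hn (hab.of_insert (h.not_reconn ((Set.subset_insert _ _).trans hX)) ha hb)⟩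

theorem reconn_of_insert (h : IsClique G H A v) (hX : insert v X ⊆ A) (ht : t ∈ A)
    (htX : t ∉ X) (hn : ∃ n ∈ X, G.Adj v n) (hr : Reconn G (insert v X) t) : Reconn H X t := by
  rw [← h.reconn_iff hX (Set.mem_insert _ _) ht, _root_.reconn_iff] at hr
  obtain ⟨n, hnX, en⟩ := hn
  have hXA := (Set.subset_insert v X).trans hX
  have key : ∀ a ∈ insert v X, H.Adj t a → ∃ a' ∈ X, H.Adj t a' ∧ ReachIn H (insert v X) a' a := by
    rintro a (rfl | ha) e
    · refine ⟨n, hnX, (h.2 t ht n (hXA hnX)).2 (Or.inr ⟨fun e => htX (e ▸ hnX), ?_, en⟩), ?_⟩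
      · exact (h.adj_iff ht).1 e.symm
      · exact .of_adj (Or.inr hnX) (Or.inl rfl) ((h.adj_iff (hXA hnX)).2 en).symm
    · exact ⟨a, ha, e, .refl (Or.inr ha)⟩
  obtain ⟨a, ha, b, hb, e1, e2, hab⟩ := hr
  obtain ⟨a', ha', ea, ra⟩ := key a ha e1
  obtain ⟨b', hb', eb, rb⟩ := key b hb e2
  refine _root_.reconn_iff.2 ⟨a', ha', b', hb', ea, eb, fun hr => hab ?_⟩
  exact (ra.symm.trans (hr.mono (Set.subset_insert _ _) le_rfl)).trans rb

variable [Finite V]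

theorem cComp_eq (h : IsClique G H X v) : cComp H X = cComp G X :=
  (cComp_eq_of_bijective id (fun _ hx => hx) (fun _ hx _ hy => h.adj_of_adj hx hy)
    (fun _ _ _ _ hr => h.reachIn_iff.1 hr) fun y hy => ⟨y, hy, .refl hy⟩).symm

theorem cComp_eq_insert (h : IsClique G H A v) (hX : insert v X ⊆ A) (hn : ∃ n ∈ X, G.Adj v n) :
    cComp H X = cComp G (insert v X) := by
  obtain ⟨n, hnX, en⟩ := hn
  have hXA := (Set.subset_insert v X).trans hX
  rw [← (h.mono hX (Set.mem_insert _ _)).cComp_eq]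
  exact (cComp_le_insert (h.not_reconn hXA)).antisymm
    (cComp_insert_le hnX ((h.adj_iff (hXA hnX)).2 en))

theorem cutIn_iff (h : IsClique G H A v) : CutIn H A T ↔ v ∉ T ∧ CutIn G A T := by
  have key : v ∉ T → (CutIn H A T ↔ CutIn G A T) := fun hv =>
    and_congr_right fun hT => forall₂_congr fun t ht =>
      h.reconn_iff Set.sdiff_subset ⟨h.1, hv⟩ (hT ht)
  constructor
  · intro hT
    have hv : v ∉ T := fun hv => h.not_reconn Set.sdiff_subset (hT.2 v hv)
    exact ⟨hv, (key hv).1 hT⟩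
  · rintro ⟨hv, hT⟩
    exact (key hv).2 hT

theorem accIn (h : IsClique G H A v) (hA : AccIn G A) : AccIn H A := by
  refine ⟨fun T hT => ?_, fun T hT hne => ?_⟩
  · obtain ⟨hv, hT⟩ := h.cutIn_iff.1 hT
    rw [(h.mono Set.sdiff_subset ⟨h.1, hv⟩).cComp_eq, h.cComp_eq, hA.unmixed T hT]
  · obtain ⟨hv, hT⟩ := h.cutIn_iff.1 hT
    obtain ⟨t, ht, hTt⟩ := hA.acc T hT hne
    exact ⟨t, ht, h.cutIn_iff.2 ⟨fun h' => hv h'.1, hTt⟩⟩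

theorem insert_sdiff (h : IsClique G H A v) (hv : v ∉ T) : insert v ((A \ {v}) \ T) = A \ T := by
  have := h.1
  grind

theorem cutIn_sdiff_iff (h : IsClique G H A v) (hg : GoodAt G A v) :
    CutIn H (A \ {v}) T ↔ (v ∉ T ∧ ∃ n ∈ (A \ {v}) \ T, G.Adj v n) ∧ CutIn G A T := by
  constructor
  · intro hT
    have hv : v ∉ T := fun hv => (hT.1 hv).2 rfl
    refine ⟨⟨hv, ?_⟩, hT.1.trans Set.sdiff_subset, fun t ht => ?_⟩
    · by_contra! hn
      have hTG : CutIn G (A \ {v}) T := by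
        refine ⟨hT.1, fun t ht => ?_⟩
        have key : ∀ x ∈ A, ∀ y ∈ (A \ {v}) \ T, H.Adj x y → G.Adj x y := fun x hx y hy e =>
          ((h.2 x hx y hy.1.1).1 e).resolve_right fun e' => hn y hy e'.2.2
        obtain ⟨S, hS, ⟨a, ha, haS, ea⟩, b, hb, hbS, eb⟩ := hT.2 t ht
        have htA := (hT.1 ht).1
        exact ⟨S, fun x hx y hy e => hS x hx y hy (h.adj_of_adj hx.1.1 hy.1.1 e),
          ⟨a, ha, haS, key t htA a ha ea⟩, b, hb, hbS, key t htA b hb eb⟩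
      obtain ⟨-, -, ⟨a, ha, -, e⟩, -⟩ := hg.2 T hTG
      exact hn a ha e
    · rw [← h.insert_sdiff hv]
      refine h.reconn_insert ?_ (hT.1 ht).1 (hT.2 t ht)
      rw [h.insert_sdiff hv]
      exact Set.sdiff_subset
  · rintro ⟨⟨hv, hn⟩, hT⟩
    refine ⟨fun t ht => ⟨hT.1 ht, fun e => hv (e ▸ ht)⟩, fun t ht => ?_⟩
    refine h.reconn_of_insert ?_ (hT.1 ht) (fun h' => h'.2 ht) hn ?_
    · rw [h.insert_sdiff hv]
      exact Set.sdiff_subset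
    · rw [h.insert_sdiff hv]
      exact hT.2 t ht

theorem accIn_sdiff (h : IsClique G H A v) (hg : GoodAt G A v) (hA : AccIn G A) :
    AccIn H (A \ {v}) := by
  have hc : ∀ T, v ∉ T → (∃ n ∈ (A \ {v}) \ T, G.Adj v n) →
      cComp H ((A \ {v}) \ T) = cComp G (A \ T) := by
    intro T hv hn
    rw [← h.insert_sdiff hv]
    refine h.cComp_eq_insert ?_ hn
    rw [h.insert_sdiff hv]
    exact Set.sdiff_subset
  obtain ⟨-, -, ⟨a, ha, -, e⟩, -⟩ := hg.reconn
  have h0 := hc ∅ (Set.notMem_empty v) ⟨a, by simpa using ha, e⟩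
  rw [Set.sdiff_empty, Set.sdiff_empty] at h0
  refine ⟨fun T hT => ?_, fun T hT hne => ?_⟩
  · obtain ⟨⟨hv, hn⟩, hT⟩ := (h.cutIn_sdiff_iff hg).1 hT
    rw [hc T hv hn, h0, hA.unmixed T hT]
  · obtain ⟨⟨hv, n, hn, en⟩, hT⟩ := (h.cutIn_sdiff_iff hg).1 hT
    obtain ⟨t, ht, hTt⟩ := hA.acc T hT hne
    exact ⟨t, ht, (h.cutIn_sdiff_iff hg).2
      ⟨⟨fun h' => hv h'.1, n, ⟨hn.1, fun h' => hn.2 h'.1⟩, en⟩, hTt⟩⟩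

end IsClique

end CliqueClosure

section Components

variable {V : Type*} {G : SimpleGraph V} {A C : Set V}

theorem reachIn_induce {X : Set C} {a b : C} :
    ReachIn (G.induce C) X a b ↔ ReachIn G (Subtype.val '' X) a b := by
  constructor
  · exact fun h => h.map Subtype.val (fun x hx => Set.mem_image_of_mem _ hx) fun _ _ _ _ e => e
  · intro h
    have ha : a ∈ X := by simpa using h.1
    obtain ⟨_, hb⟩ := h.mem_of_closed (S := {c | ∃ hc : c ∈ C, ReachIn (G.induce C) X a ⟨c, hc⟩})
      (by
        rintro _ ⟨x, hx, rfl⟩ _ ⟨y, hy, rfl⟩ e ⟨_, hax⟩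
        exact ⟨y.2, hax.trans (.of_adj hx hy e)⟩) ⟨a.2, .refl ha⟩
    exact hb

theorem reconn_induce {X : Set C} {t : C} :
    Reconn (G.induce C) X t ↔ Reconn G (Subtype.val '' X) t := by
  rw [reconn_iff, reconn_iff]
  simp only [reachIn_induce, Set.exists_mem_image, SimpleGraph.comap_adj,
    Function.Embedding.subtype_apply]

theorem cComp_induce [Finite V] (X : Set C) :
    cComp (G.induce C) X = cComp G (Subtype.val '' X) :=
  cComp_eq_of_bijective Subtype.val (fun x hx => ⟨x, hx, rfl⟩) (fun _ _ _ _ e => e)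
    (fun _ _ _ _ h => reachIn_induce.2 h) fun _ hy => by
      obtain ⟨x, hx, rfl⟩ := hy
      exact ⟨x, hx, .refl ⟨x, hx, rfl⟩⟩

theorem image_compl_eq_sdiff (T : Set C) :
    Subtype.val '' Tᶜ = C \ (Subtype.val '' T) := by
  rw [Set.image_compl_eq_range_sdiff_image Subtype.val_injective, Subtype.range_coe]

theorem reachIn_setOf_subset (G : SimpleGraph V) (A : Set V) (a : V) :
    {x | ReachIn G A a x} ⊆ A := fun _ hx => hx.2.1

theorem reachIn_setOf_closed (G : SimpleGraph V) (A : Set V) (a : V) :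
    ∀ x ∈ {x | ReachIn G A a x}, ∀ y ∈ A, G.Adj x y → y ∈ {x | ReachIn G A a x} :=
  fun _ hx _ hy e => hx.trans (.of_adj hx.2.1 hy e)

theorem reconn_sdiff_iff_of_closed (hC : C ⊆ A) (hcl : ∀ x ∈ C, ∀ y ∈ A, G.Adj x y → y ∈ C) (T : Set V)
    {t : V} (ht : t ∈ C) : Reconn G (A \ T) t ↔ Reconn G (C \ T) t := by
  constructor
  · exact fun h => h.restrict (Set.sdiff_subset_sdiff_left hC) fun y hy e =>
      ⟨hcl t ht y hy.1 e, hy.2⟩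
  · exact fun h => h.lift (Set.sdiff_subset_sdiff_left hC) fun x hx y hy e =>
      ⟨hcl x hx.1 y hy.1 e, hy.2⟩

theorem cut_induce_iff (hC : C ⊆ A) (hcl : ∀ x ∈ C, ∀ y ∈ A, G.Adj x y → y ∈ C) {T : Set C} :
    Cut (G.induce C) T ↔ CutIn G A (Subtype.val '' T) := by
  simp only [Cut, CutIn, Set.forall_mem_image, reconn_induce, image_compl_eq_sdiff]
  constructor
  · intro h
    refine ⟨?_, fun t ht => (reconn_sdiff_iff_of_closed hC hcl _ t.2).2 (h t ht)⟩
    rintro _ ⟨t, -, rfl⟩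
    exact hC t.2
  · exact fun h t ht => (reconn_sdiff_iff_of_closed hC hcl _ t.2).1 (h.2 ht)

variable [Finite V]

theorem cComp_sdiff_of_closed (hC : C ⊆ A) (hcl : ∀ x ∈ C, ∀ y ∈ A, G.Adj x y → y ∈ C) {T : Set V}
    (hT : T ⊆ C) : cComp G (A \ T) = cComp G (C \ T) + cComp G (A \ C) := by
  rw [← cComp_union (Set.disjoint_left.2 fun x hx hx' => hx'.2 hx.1)
    fun x hx y hy e => hy.2 (hcl x hx.1 y hy.1 e)]
  congr 1
  grind

theorem AccIn.connAccessible {a : V} (hA : AccIn G A) (ha : a ∈ A) :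
    ConnAccessible (G.induce {x | ReachIn G A a x}) := by
  have hC := reachIn_setOf_subset G A a
  have hcl := reachIn_setOf_closed G A a
  refine ⟨?_, fun T hT => ?_, fun T hT hne => ?_⟩
  · rintro S ⟨s, hs⟩ hS b
    have hsb : ReachIn G A s b := s.2.symm.trans b.2
    obtain ⟨_, hb⟩ := hsb.mem_of_closed (S := {c | ∃ hc : ReachIn G A a c, ⟨c, hc⟩ ∈ S})
      (fun x _ y hy e ⟨hx, hxS⟩ => ⟨hcl x hx y hy e, hS ⟨x, hx⟩ hxS ⟨y, _⟩ e⟩) ⟨s.2, hs⟩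
    exact hb
  · have hTA := (cut_induce_iff hC hcl).1 hT
    have h1 := hA.unmixed _ hTA
    have h2 := cComp_sdiff_of_closed hC hcl (T := ∅) (Set.empty_subset _)
    have h3 : cComp G {x | ReachIn G A a x} = 1 := by
      refine cComp_eq_one_of_reach (a := a) (.refl ha) fun b hb => ?_
      refine ReachIn.mem_of_closed (S := {c | ReachIn G {x | ReachIn G A a x} a c}) hb ?_
        (.refl (.refl ha))
      exact fun x _ y hy e hx => hx.trans (.of_adj hx.2.1 (hcl x hx.2.1 y hy e) e)
    rw [cComp_sdiff_of_closed hC hcl (by rintro _ ⟨t, -, rfl⟩; exact t.2),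
      Set.ncard_image_of_injective _ Subtype.val_injective] at h1
    rw [Set.sdiff_empty, Set.sdiff_empty, h3] at h2
    rw [cComp_induce, image_compl_eq_sdiff]
    omega
  · obtain ⟨_, ⟨t, ht, rfl⟩, hTt⟩ := hA.acc _ ((cut_induce_iff hC hcl).1 hT) (hne.image _)
    refine ⟨t, ht, (cut_induce_iff hC hcl).2 ?_⟩
    rwa [Set.image_sdiff Subtype.val_injective, Set.image_singleton]

theorem AccIn.exists_goodAt (hA : AccIn G A) {a b : V} (hab : ReachIn G A a b) (hne : a ≠ b)
    (hnab : ¬ G.Adj a b) (h3 : {w | CutVertexOn G A w ∧ ReachIn G A a w}.ncard ≤ 3) :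
    ∃ v, GoodAt G A v := by
  have hC := reachIn_setOf_subset G A a
  have hcl := reachIn_setOf_closed G A a
  obtain ⟨x, hx, hgood⟩ := (hA.connAccessible hab.1).exists_good
    (a := ⟨a, .refl hab.1⟩) (b := ⟨b, hab⟩) (fun e => hne (congrArg Subtype.val e)) hnab (by
      refine le_trans ?_ h3
      rw [← Set.ncard_image_of_injective _ Subtype.val_injective]
      refine Set.ncard_le_ncard ?_
      rintro _ ⟨x, hx, rfl⟩
      have hx' := (cut_induce_iff hC hcl).1 hx
      rw [Set.image_singleton, cutIn_singleton] at hx'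
      exact ⟨hx', x.2⟩)
  refine ⟨x, hC x.2, fun T hT => ?_⟩
  have himg : Subtype.val '' (insert x (Subtype.val ⁻¹' T))ᶜ =
      {y | ReachIn G A a y} \ insert (x : V) T := by
    rw [image_compl_eq_sdiff, Set.image_insert_eq, Subtype.image_preimage_coe]
    grind
  rw [← sdiff_insert_eq, reconn_sdiff_iff_of_closed hC hcl _ x.2, ← himg, ← reconn_induce]
  refine hgood _ (fun hxT => (hT.1 hxT).2 rfl) fun t ht => ?_
  rw [reconn_induce, himg, ← reconn_sdiff_iff_of_closed hC hcl _ t.2, sdiff_insert_eq]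
  exact hT.2 t ht

end Components

section Induction

variable {V : Type*}

/-- Every connected component of `G[A]` has at most three cut vertices, and this persists when
cut vertices are removed successively. -/
inductive FewCuts (G : SimpleGraph V) : Set V → Prop
  | mk (A : Set V) (h : ∀ a, {w | CutVertexOn G A w ∧ ReachIn G A a w}.ncard ≤ 3)
      (hdel : ∀ x, CutVertexOn G A x → FewCuts G (A \ {x})) : FewCuts G A

variable [Finite V] {G H : SimpleGraph V} {A : Set V} {v : V}

theorem StronglyRCutConn.fewCuts (h : StronglyRCutConn 3 G A)
    (h3 : ∀ a, {w | CutVertexOn G A w ∧ ReachIn G A a w}.ncard ≤ 3) : FewCuts G A := by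
  induction h with
  | mk A hconn _ ih =>
    refine ⟨A, h3, fun x hx => ih x hx fun a => ?_⟩
    have hC := reachIn_setOf_subset G A
    have hcl := reachIn_setOf_closed G A
    by_cases hax : ReachIn G A x a ∧ a ≠ x
    · have hxC : CutVertexOn G {y | ReachIn G A x y} x :=
        cutVertexOn_iff.2 ⟨.refl hx.1, (reconn_sdiff_iff_of_closed (hC x) (hcl x) _
          (.refl hx.1)).1 (cutVertexOn_iff.1 hx).2⟩
      refine le_trans (Set.ncard_le_ncard ?_)
        (((hconn x hx.1).resolve_left fun h' => h' x hxC) x hxC a hax)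
      rintro w ⟨hw, haw⟩
      have key : ReachIn G ({y | ReachIn G A x y} \ {x}) a w := by
        refine haw.mem_of_closed (S := {c | ReachIn G ({y | ReachIn G A x y} \ {x}) a c}) ?_
          (.refl hax)
        exact fun y _ z hz e hy =>
          hy.trans (.of_adj hy.2.1 ⟨hcl x y hy.2.1.1 z hz.1 e, hz.2⟩ e)
      refine ⟨cutVertexOn_iff.2 ⟨key.2.1, ?_⟩, key⟩
      rw [← sdiff_insert_eq, ← reconn_sdiff_iff_of_closed (hC x) (hcl x) _ key.2.1.1,
        sdiff_insert_eq]
      exact (cutVertexOn_iff.1 hw).2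
    · refine le_trans (Set.ncard_le_ncard ?_) (h3 a)
      rintro w ⟨hw, haw⟩
      have haw' := haw.mono Set.sdiff_subset le_rfl
      refine ⟨cutVertexOn_iff.2 ⟨hw.1.1, ?_⟩, haw'⟩
      have hxa : x ∉ {y | ReachIn G A a y} := fun h' => hax ⟨h'.symm, haw.1.2⟩
      rw [reconn_sdiff_iff_of_closed (hC a) (hcl a) _ haw']
      have h1 := (cutVertexOn_iff.1 hw).2
      rw [← sdiff_insert_eq, reconn_sdiff_iff_of_closed (hC a) (hcl a) _ haw'] at h1
      have h2 : {y | ReachIn G A a y} \ insert x {w} = {y | ReachIn G A a y} \ {w} := by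
        grind
      rwa [h2] at h1

theorem IsClique.cutVertexOn_of (h : IsClique G H A v) {w : V} (hw : CutVertexOn H A w) :
    w ≠ v ∧ CutVertexOn G A w := by
  have h1 := h.cutIn_iff.1 (cutIn_singleton.2 hw)
  exact ⟨fun e => h1.1 e.symm, cutIn_singleton.1 h1.2⟩

theorem IsClique.fewCuts (h : IsClique G H A v) (hG : FewCuts G A) : FewCuts H A := by
  induction hG with
  | mk A h3 _ ih =>
    refine ⟨A, fun a => (Set.ncard_le_ncard ?_).trans (h3 a), fun w hw => ?_⟩
    · exact fun w ⟨hw, haw⟩ => ⟨(h.cutVertexOn_of hw).2, h.reachIn_iff.1 haw⟩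
    · obtain ⟨hwv, hw⟩ := h.cutVertexOn_of hw
      exact ih w hw (h.mono Set.sdiff_subset ⟨h.1, hwv.symm⟩)

theorem IsClique.fewCuts_sdiff (h : IsClique G H A v) (hG : FewCuts G A) :
    FewCuts H (A \ {v}) := by
  induction hG with
  | mk A h3 _ ih =>
    have key : ∀ w, CutVertexOn H (A \ {v}) w → v ≠ w ∧ CutVertexOn G A w := by
      intro w hw
      obtain ⟨hwA, hw⟩ := cutVertexOn_iff.1 hw
      have hvw : v ≠ w := fun e => hwA.2 e.symm
      have h1 : insert v ((A \ {v}) \ {w}) = A \ {w} := h.insert_sdiff hvw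
      refine ⟨hvw, cutVertexOn_iff.2 ⟨hwA.1, ?_⟩⟩
      rw [← h1]
      refine h.reconn_insert ?_ hwA.1 hw
      rw [h1]
      exact Set.sdiff_subset
    refine ⟨_, fun a => (Set.ncard_le_ncard ?_).trans (h3 a), fun w hw => ?_⟩
    · exact fun w ⟨hw, haw⟩ => ⟨(key w hw).2, h.reachIn_iff.1 (haw.mono Set.sdiff_subset le_rfl)⟩
    · obtain ⟨hvw, hw⟩ := key w hw
      rw [sdiff_right_comm]
      exact ih w hw (h.mono Set.sdiff_subset ⟨h.1, hvw⟩)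

theorem cutIn_coe_iff [DecidableEq V] {T : Finset V} : CutIn G A ↑T ↔ CutsetOn G A T :=
  cutsetOn_iff.symm

theorem AccIn.unmixedOn [DecidableEq V] (hA : AccIn G A) : UnmixedOn G A := fun T hT => by
  rw [hA.unmixed _ (cutIn_coe_iff.2 hT), Set.ncard_coe_finset]

theorem AccessibleOn.accIn [DecidableEq V] (hA : AccessibleOn G A) : AccIn G A := by
  refine ⟨fun T hT => ?_, fun T hT hne => ?_⟩ <;>
    obtain ⟨T, rfl⟩ := T.toFinite.exists_finset_coe
  · rw [hA.1 T (cutIn_coe_iff.1 hT), Set.ncard_coe_finset]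
  · obtain ⟨t, ht, hTt⟩ := hA.2 T (cutIn_coe_iff.1 hT) (by simpa using hne)
    refine ⟨t, ht, ?_⟩
    rw [← Finset.coe_erase]
    exact cutIn_coe_iff.2 hTt

theorem AccIn.stronglyUnmixedOn [DecidableEq V] (hA : AccIn G A) (hG : FewCuts G A) :
    StronglyUnmixedOn G A := by
  induction hn : A.ncard using Nat.strong_induction_on generalizing G A with
  | _ n ihn =>
  subst hn
  induction hk : {x | CutVertexOn G A x}.ncard using Nat.strong_induction_on generalizing G with
  | _ k ihk =>
  subst hk
  by_cases hcomplete : ∀ a b : A, (G.induce A).Reachable a b → a ≠ b → (G.induce A).Adj a b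
  · exact .complete G A hcomplete
  push Not at hcomplete
  obtain ⟨a, b, hab, hne, hnab⟩ := hcomplete
  obtain ⟨v, hv⟩ := hA.exists_goodAt (a := a) (b := b) ⟨a.2, b.2, hab⟩
    (fun e => hne (Subtype.ext e)) hnab (by obtain ⟨_, h3, _⟩ := hG; exact h3 a)
  have hclq := isClique_cliqueAtOn G hv.1
  have hlt : (A \ {v}).ncard < A.ncard := Set.ncard_sdiff_singleton_lt_of_mem hv.1
  refine .cut G A hA.unmixedOn v hv.cutVertexOn ?_ ?_ ?_
  · obtain ⟨_, _, hdel⟩ := hG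
    exact ihn _ hlt (hv.accIn_sdiff hA) (hdel v hv.cutVertexOn) rfl
  · refine ihk _ (Set.ncard_lt_ncard ?_) (hclq.accIn hA) (hclq.fewCuts hG) rfl
    refine ⟨fun w hw => (hclq.cutVertexOn_of hw).2, fun hsub => ?_⟩
    exact (hclq.cutVertexOn_of (hsub hv.cutVertexOn)).1 rfl
  · exact ihn _ hlt (hclq.accIn_sdiff hv hA) (hclq.fewCuts_sdiff hG) rfl

end Induction

/-- if `G` is a strongly `3`-cut-connected graph in which every
connected component contains at most three cut vertices, and `G` is accessible,
then `J_G` is strongly unmixed. -/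
theorem stronglyUnmixed_of_strongly3CutConn {V : Type u} [Fintype V] [DecidableEq V]
    (G : SimpleGraph V)
    (hscc : StronglyRCutConn 3 G Set.univ)
    (hthree : ∀ a : V,
      Set.ncard {x | CutVertexOn G Set.univ x ∧ ReachIn G Set.univ a x} ≤ 3)
    (hacc : AccessibleOn G Set.univ) :
    StronglyUnmixedOn G Set.univ := by
  exact hacc.accIn.stronglyUnmixedOn (hscc.fewCuts hthree)
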